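/- arXiv:1806.06199 — 7 statements merged into one kernel-verified Lean document; each statement's English description precedes it below -/
import Mathlib

section
/- Let k ≥ 3 and n ≥ 1. A complex number λ is an eigenvalue of the k-uniform hyperpath P_n^k if and only if λ = 0 or M_s(λ^k) = 0 for some s ∈ {1, …, n}. -/
open Finset

/-- `λ` is an eigenvalue of the `k`-uniform hypergraph with vertex type `V` and
edge set `E`: there is a nonzero `x : V → ℂ` with
`∑_{e ∈ E, v ∈ e} ∏_{u ∈ e, u ≠ v} x u = λ · (x v)^(k-1)` for every vertex `v`. -/
def IsEigenvalue {V : Type*} [Fintype V] [DecidableEq V] (k : ℕ)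
    (E : Finset (Finset V)) (lam : ℂ) : Prop :=
  ∃ x : V → ℂ, x ≠ 0 ∧ ∀ v : V,
    ∑ e ∈ E.filter (fun e => v ∈ e), ∏ u ∈ e.erase v, x u = lam * (x v) ^ (k - 1)

/-- The edge `e_t = {(t-1)(k-1), …, t(k-1)}` of the hyperpath, inside `Fin N`. -/
def pathEdge (k t N : ℕ) : Finset (Fin N) :=
  univ.filter (fun v => (t - 1) * (k - 1) ≤ v.val ∧ v.val ≤ t * (k - 1))

/-- The edge set of the `k`-uniform hyperpath `P_n^k` on vertices `{0, …, n(k-1)}`. -/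
def pathEdges (k n : ℕ) : Finset (Finset (Fin (n * (k - 1) + 1))) :=
  (Finset.Icc 1 n).image (fun t => pathEdge k t (n * (k - 1) + 1))

/-- The polynomials `M_s`, evaluated: `M_0 = 1`, `M_1 = t - 1`,
`M_s = t·(M_{s-1} - M_{s-2})` for `s ≥ 2`. -/
noncomputable def Mpoly : ℕ → ℂ → ℂ
  | 0, _ => 1
  | 1, z => z - 1
  | (s + 2), z => z * (Mpoly (s + 1) z - Mpoly s z)

/-- The eigenvalue equation of the hyperpath, phrased for vectors indexed by natural numbers. -/
theorem isEigenvalue_pathEdges_iff {k : ℕ} (n : ℕ) (hk : 2 ≤ k) (lam : ℂ) :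
    IsEigenvalue k (pathEdges k n) lam ↔ ∃ x : ℕ → ℂ, (∃ v ≤ n * (k - 1), x v ≠ 0) ∧
      ∀ v ≤ n * (k - 1), ∑ i ∈ range n with v ∈ Icc (i * (k - 1)) ((i + 1) * (k - 1)),
        ∏ u ∈ (Icc (i * (k - 1)) ((i + 1) * (k - 1))).erase v, x u = lam * x v ^ (k - 1) := by
  obtain ⟨m, rfl⟩ : ∃ m, k = m + 2 := ⟨k - 2, by omega⟩
  simp only [show m + 2 - 1 = m + 1 from rfl]
  have hmap : ∀ i < n, (pathEdge (m + 2) (i + 1) (n * (m + 1) + 1)).map Fin.valEmbedding =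
      Icc (i * (m + 1)) ((i + 1) * (m + 1)) := by
    intro i hi
    have : (i + 1) * (m + 1) ≤ n * (m + 1) := Nat.mul_le_mul_right _ hi
    ext u
    simp only [pathEdge, mem_map, mem_filter, mem_univ, true_and, Fin.valEmbedding_apply, mem_Icc]
    constructor
    · rintro ⟨a, ha, rfl⟩
      simpa using ha
    · intro hu
      exact ⟨⟨u, by omega⟩, by simpa using hu, rfl⟩
  have hset : pathEdges (m + 2) n =
      (range n).image (fun i => pathEdge (m + 2) (i + 1) (n * (m + 1) + 1)) := by
    ext e
    simp only [pathEdges, mem_image, mem_Icc, mem_range]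
    constructor
    · rintro ⟨t, ht, rfl⟩
      exact ⟨t - 1, by omega, by rw [Nat.sub_add_cancel ht.1]; rfl⟩
    · rintro ⟨t, ht, rfl⟩
      exact ⟨t + 1, by omega, rfl⟩
  have hinj : Set.InjOn (fun i => pathEdge (m + 2) (i + 1) (n * (m + 1) + 1))
      (range n : Set ℕ) := by
    intro i hi j hj hij
    have h := congrArg (Finset.map Fin.valEmbedding) hij
    simp only [coe_range, Set.mem_Iio] at hi hj
    simp only [hmap i hi, hmap j hj] at h
    have h₁ : i * (m + 1) ∈ Icc (j * (m + 1)) ((j + 1) * (m + 1)) := by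
      rw [← h]; simp only [mem_Icc]; constructor <;> nlinarith
    have h₂ : j * (m + 1) ∈ Icc (i * (m + 1)) ((i + 1) * (m + 1)) := by
      rw [h]; simp only [mem_Icc]; constructor <;> nlinarith
    simp only [mem_Icc] at h₁ h₂
    exact Nat.eq_of_mul_eq_mul_right (Nat.succ_pos m) (le_antisymm h₂.1 h₁.1)
  have hsum : ∀ (x : ℕ → ℂ) (v : Fin (n * (m + 1) + 1)),
      ∑ e ∈ (pathEdges (m + 2) n).filter (fun e => v ∈ e), ∏ u ∈ e.erase v, x u =
      ∑ i ∈ range n with (v : ℕ) ∈ Icc (i * (m + 1)) ((i + 1) * (m + 1)),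
        ∏ u ∈ (Icc (i * (m + 1)) ((i + 1) * (m + 1))).erase v, x u := by
    intro x v
    rw [sum_filter, sum_filter, hset]
    refine (sum_image hinj).trans (sum_congr rfl fun i hi => ?_)
    rw [← hmap i (mem_range.1 hi)]
    have hmem : ((v : ℕ) ∈ (pathEdge (m + 2) (i + 1) (n * (m + 1) + 1)).map Fin.valEmbedding) ↔
        v ∈ pathEdge (m + 2) (i + 1) (n * (m + 1) + 1) :=
      mem_map' Fin.valEmbedding
    have herase := map_erase Fin.valEmbedding (pathEdge (m + 2) (i + 1) (n * (m + 1) + 1)) v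
    rw [Fin.valEmbedding_apply] at herase
    simp only [hmem, ← herase, prod_map, Fin.valEmbedding_apply]
    rfl
  constructor
  · rintro ⟨y, hy, hev⟩
    set x : ℕ → ℂ := fun u => if h : u < n * (m + 1) + 1 then y ⟨u, h⟩ else 0 with hx
    have hxy : ∀ v : Fin (n * (m + 1) + 1), x v = y v := fun v => dif_pos v.2
    obtain ⟨v, hv⟩ := Function.ne_iff.1 hy
    refine ⟨x, ⟨v, Nat.lt_succ_iff.1 v.2, by rwa [hxy]⟩, fun w hw => ?_⟩
    have h := hev ⟨w, Nat.lt_succ_iff.2 hw⟩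
    simp only [← hxy] at h
    rw [hsum] at h
    exact h
  · rintro ⟨x, ⟨v, hv, hxv⟩, hev⟩
    refine ⟨fun v => x v, fun h => hxv ?_, fun w => ?_⟩
    · exact congrFun h ⟨v, Nat.lt_succ_iff.2 hv⟩
    · rw [hsum]
      exact hev w (Nat.lt_succ_iff.1 w.2)

/-- A vertex interior to the `i`-th edge lies on no other edge. -/
theorem sum_edges_interior {m n i r : ℕ} (f : ℕ → ℂ) (hi : i < n) (hr : 0 < r) (hrm : r < m) :
    ∑ j ∈ range n with i * m + r ∈ Icc (j * m) ((j + 1) * m), f j = f i := by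
  have : ({j ∈ range n | i * m + r ∈ Icc (j * m) ((j + 1) * m)} : Finset ℕ) = {i} := by
    ext j
    simp only [mem_filter, mem_range, mem_Icc, mem_singleton]
    constructor
    · rintro ⟨-, h₁, h₂⟩
      have : j < i + 1 := lt_of_mul_lt_mul_right (a := m) (by nlinarith) (Nat.zero_le _)
      have : i < j + 1 := lt_of_mul_lt_mul_right (a := m) (by nlinarith) (Nat.zero_le _)
      omega
    · rintro rfl
      exact ⟨hi, by omega, by nlinarith⟩
  rw [this, sum_singleton]

/-- The `t`-th junction vertex lies exactly on the `t`-th and the `(t+1)`-st edge. -/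
theorem sum_edges_junction {m n t : ℕ} (f : ℕ → ℂ) (hm : 0 < m) (ht : t ≤ n) (h0 : f 0 = 0)
    (hn : f (n + 1) = 0) :
    ∑ j ∈ range n with t * m ∈ Icc (j * m) ((j + 1) * m), f (j + 1) = f t + f (t + 1) := by
  have hcond : ∀ j, t * m ∈ Icc (j * m) ((j + 1) * m) ↔ j = t ∨ j + 1 = t := by
    intro j
    rw [mem_Icc, Nat.mul_le_mul_right_iff hm, Nat.mul_le_mul_right_iff hm]
    omega
  simp only [hcond]
  have hsum : ∑ j ∈ range n with (j = t ∨ j + 1 = t), f (j + 1) =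
      ∑ j ∈ ({t, t + 1} : Finset ℕ), f j := by
    refine (sum_map _ (addRightEmbedding 1) f).symm.trans (sum_subset ?_ ?_)
    · intro j
      simp only [mem_map, mem_filter, mem_range, addRightEmbedding_apply, mem_insert,
        mem_singleton]
      omega
    · intro j hj hj'
      simp only [mem_insert, mem_singleton] at hj
      simp only [mem_map, mem_filter, mem_range, addRightEmbedding_apply, not_exists,
        not_and] at hj'
      rcases Nat.eq_zero_or_pos j with rfl | hpos
      · exact h0
      · have := hj' (j - 1)
        obtain rfl : j = n + 1 := by omega
        exact hn
  rw [hsum, sum_pair (by omega)]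

theorem prod_Icc_edge (d i : ℕ) (x : ℕ → ℂ) :
    ∏ u ∈ Icc (i * (d + 2)) ((i + 1) * (d + 2)), x u =
      x (i * (d + 2)) * (∏ r ∈ range (d + 1), x (i * (d + 2) + (r + 1))) *
        x ((i + 1) * (d + 2)) := by
  have : Icc (i * (d + 2)) ((i + 1) * (d + 2)) =
      Ico (i * (d + 2)) ((i + 1) * (d + 2) + 1) := by
    ext; simp
  rw [this, prod_Ico_eq_prod_range,
    show (i + 1) * (d + 2) + 1 - i * (d + 2) = (d + 1) + 1 + 1 by
      rw [show (i + 1) * (d + 2) = i * (d + 2) + (d + 2) by ring]; omega,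
    prod_range_succ, prod_range_succ', add_zero,
    show i * (d + 2) + (d + 1 + 1) = (i + 1) * (d + 2) by ring]
  ring

/-- Multiplying an eigenvalue equation by the coordinate of its vertex. -/
theorem mul_sum_prod_erase (m n v : ℕ) (x : ℕ → ℂ) :
    x v * ∑ i ∈ range n with v ∈ Icc (i * m) ((i + 1) * m),
        ∏ u ∈ (Icc (i * m) ((i + 1) * m)).erase v, x u =
      ∑ i ∈ range n with v ∈ Icc (i * m) ((i + 1) * m), ∏ u ∈ Icc (i * m) ((i + 1) * m), x u := by
  rw [mul_sum]
  exact sum_congr rfl fun i hi => mul_prod_erase _ _ (mem_filter.1 hi).2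

theorem sum_range_Mpoly (s : ℕ) (z : ℂ) :
    ∑ j ∈ range (s + 2), Mpoly j z = z * Mpoly s z := by
  induction s with
  | zero => simp [sum_range_succ, Mpoly]
  | succ s ih => rw [sum_range_succ, ih, Mpoly]; ring

/-- Along a run of nonzero terms, consecutive terms of a solution of the edge recurrence have
ratio `M_{i+1} / ∑_{j ≤ i} M_j`. -/
theorem Mpoly_mul_eq_of_recurrence {z : ℂ} {q : ℕ → ℂ} (h0 : q 0 = 0)
    (hrec : ∀ i, q (i + 1) ≠ 0 →
      z * q (i + 1) ^ 2 = (q i + q (i + 1)) * (q (i + 1) + q (i + 2)))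
    (i : ℕ) (hq : ∀ j ≤ i, q (j + 1) ≠ 0) :
    (∑ j ∈ range (i + 1), Mpoly j z) * q (i + 2) = Mpoly (i + 1) z * q (i + 1) := by
  induction i with
  | zero =>
    have h := hrec 0 (hq 0 le_rfl)
    have hq1 := hq 0 le_rfl
    simp only [zero_add, h0] at h hq1 ⊢
    apply mul_left_cancel₀ hq1
    simp only [sum_range_one, Mpoly]
    linear_combination -h
  | succ i ih =>
    have h := ih fun j hj => hq j (by omega)
    have hr := hrec (i + 1) (hq (i + 1) le_rfl)
    have hq2 := hq (i + 1) le_rfl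
    have hs := sum_range_Mpoly (i + 1) z
    rw [sum_range_succ, sum_range_succ] at hs
    rw [sum_range_succ]
    apply mul_left_cancel₀ hq2
    linear_combination (q (i + 2) + q (i + 3)) * h - Mpoly (i + 1) z * hr - q (i + 2) ^ 2 * hs

theorem exists_Mpoly_eq_zero_of_recurrence {z : ℂ} {q : ℕ → ℂ} {n t : ℕ} (h0 : q 0 = 0)
    (hn : q (n + 1) = 0) (ht : t ≤ n) (hqt : q t ≠ 0)
    (hrec : ∀ i, q (i + 1) ≠ 0 →
      z * q (i + 1) ^ 2 = (q i + q (i + 1)) * (q (i + 1) + q (i + 2))) :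
    ∃ s, 1 ≤ s ∧ s ≤ n ∧ Mpoly s z = 0 := by
  classical
  have hex : ∃ a, q a ≠ 0 := ⟨t, hqt⟩
  obtain ⟨b, hb⟩ : ∃ b, Nat.find hex = b + 1 :=
    Nat.exists_eq_succ_of_ne_zero fun h => Nat.find_spec hex (by rw [h, h0])
  have hb1 : q (b + 1) ≠ 0 := hb ▸ Nat.find_spec hex
  have hb0 : q b = 0 := not_not.1 (Nat.find_min hex (by omega))
  have hbt : b + 1 ≤ t := hb ▸ Nat.find_min' hex hqt
  have hend : ∃ j, q (b + (j + 2)) = 0 :=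
    ⟨n - b - 1, by rwa [show b + (n - b - 1 + 2) = n + 1 by omega]⟩
  have hjn : Nat.find hend ≤ n - b - 1 :=
    Nat.find_min' hend (by rwa [show b + (n - b - 1 + 2) = n + 1 by omega])
  have hne : ∀ i ≤ Nat.find hend, q (b + (i + 1)) ≠ 0 := by
    rintro (_ | i) hi
    · exact hb1
    · exact Nat.find_min hend hi
  have h := Mpoly_mul_eq_of_recurrence (z := z) (q := fun i => q (b + i)) hb0
    (fun i hi => hrec (b + i) hi) (Nat.find hend) hne
  simp only [Nat.find_spec hend, mul_zero] at h
  exact ⟨Nat.find hend + 1, by omega, by omega,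
    (mul_eq_zero.1 h.symm).resolve_right (hne _ le_rfl)⟩

theorem exists_recurrence_of_Mpoly_eq_zero {z : ℂ} {n s : ℕ} (hz : z ≠ 0)
    (hsn : s ≤ n) (hM : Mpoly s z = 0) :
    ∃ q : ℕ → ℂ, q 0 = 0 ∧ q 1 ≠ 0 ∧ q (n + 1) = 0 ∧
      (∀ i, q (i + 1) = 0 → q (i + 2) = 0) ∧
      ∀ i, z * q (i + 1) ^ 2 = (q i + q (i + 1)) * (q (i + 1) + q (i + 2)) := by
  classical
  have hex : ∃ s, Mpoly s z = 0 := ⟨s, hM⟩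
  set l := Nat.find hex with hl
  have hls : l ≤ s := Nat.find_min' hex hM
  have hl0 : Mpoly l z = 0 := Nat.find_spec hex
  have hlpos : 1 ≤ l := by
    rcases Nat.eq_zero_or_pos l with h | h
    · rw [h] at hl0; simp [Mpoly] at hl0
    · exact h
  have hlt : ∀ j < l, Mpoly j z ≠ 0 := fun j hj => Nat.find_min hex hj
  set L : ℕ → ℂ := fun i => ∑ j ∈ range (i + 1), Mpoly j z with hL
  have hL0 : L 0 = 1 := by simp [hL, Mpoly]
  have hLs : ∀ i, L (i + 1) = z * Mpoly i z := fun i => sum_range_Mpoly i z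
  have hLM : ∀ i, L (i + 1) = L i + Mpoly (i + 1) z := fun i => sum_range_succ _ _
  have hLne : ∀ i < l, L i ≠ 0 := by
    rintro (_ | i) hi
    · rw [hL0]; exact one_ne_zero
    · rw [hLs]; exact mul_ne_zero hz (hlt i (by omega))
  set p : ℕ → ℂ := fun i => ∏ j ∈ range i, Mpoly (j + 1) z / L j with hp
  have hpz : ∀ i, l ≤ i → p i = 0 := fun i hi =>
    prod_eq_zero (mem_range.2 (show l - 1 < i by omega))
      (by rw [Nat.sub_add_cancel hlpos, hl0, zero_div])
  have hps : ∀ i, p (i + 1) = p i * (Mpoly (i + 1) z / L i) := fun i => prod_range_succ _ _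
  have hpL : ∀ i < l, L i * p (i + 1) = Mpoly (i + 1) z * p i := fun i hi => by
    rw [hps]; field_simp [hLne i hi]
  refine ⟨fun i => if i = 0 then 0 else p (i - 1), by simp, by simp [hp], ?_, ?_, ?_⟩
  · simpa using hpz n (hls.trans hsn)
  · intro i hi
    simp only [Nat.add_eq_zero_iff, one_ne_zero, and_false, if_false, Nat.add_sub_cancel,
      OfNat.ofNat_ne_zero] at hi ⊢
    rw [show i + 2 - 1 = i + 1 by omega, hps, hi, zero_mul]
  · rintro (_ | i)
    · have h := hpL 0 hlpos
      have h1 : p 0 = 1 := by simp [hp]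
      simp only [hL0, h1, Mpoly] at h
      simp [h1]
      linear_combination -h
    · simp only [Nat.add_eq_zero_iff, one_ne_zero, and_false, if_false, Nat.add_sub_cancel,
        OfNat.ofNat_ne_zero]
      rw [show i + 1 + 2 - 1 = i + 2 by omega]
      rcases lt_or_ge (i + 1) l with hi | hi
      · have h₁ := hpL i (by omega)
        have h₂ := hpL (i + 1) hi
        have hs₁ := hLs (i + 1)
        have hM₁ := hLM i
        have hM₂ := hLM (i + 1)
        apply mul_left_cancel₀ (hlt (i + 1) hi)
        have e₁ : Mpoly (i + 1) z * (p i + p (i + 1)) = L (i + 1) * p (i + 1) := by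
          linear_combination -h₁ - p (i + 1) * hM₁
        have e₂ : L (i + 1) * (p (i + 1) + p (i + 2)) = L (i + 2) * p (i + 1) := by
          linear_combination h₂ - p (i + 1) * hM₂
        linear_combination (-(p (i + 1) + p (i + 2))) * e₁ - p (i + 1) * e₂ - p (i + 1) ^ 2 * hs₁
      · simp [hpz (i + 1) hi, hpz (i + 2) (by omega)]

theorem exists_Mpoly_eq_zero_of_eigenvector {d n : ℕ} {lam : ℂ} (hlam : lam ≠ 0) {x : ℕ → ℂ}
    (hx : ∃ v ≤ n * (d + 2), x v ≠ 0)
    (hev : ∀ v ≤ n * (d + 2), ∑ i ∈ range n with v ∈ Icc (i * (d + 2)) ((i + 1) * (d + 2)),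
      ∏ u ∈ (Icc (i * (d + 2)) ((i + 1) * (d + 2))).erase v, x u = lam * x v ^ (d + 2)) :
    ∃ s, 1 ≤ s ∧ s ≤ n ∧ Mpoly s (lam ^ (d + 3)) = 0 := by
  set q : ℕ → ℂ := fun t => if 1 ≤ t ∧ t ≤ n then
    ∏ u ∈ Icc ((t - 1) * (d + 2)) ((t - 1 + 1) * (d + 2)), x u else 0 with hq
  have hq0 : q 0 = 0 := by simp [hq]
  have hqn : q (n + 1) = 0 := by simp [hq]
  have hqi : ∀ i < n, q (i + 1) = ∏ u ∈ Icc (i * (d + 2)) ((i + 1) * (d + 2)), x u := by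
    intro i hi
    simp [hq, Nat.succ_le_of_lt hi]
  have hE : ∀ v ≤ n * (d + 2), ∑ i ∈ range n with v ∈ Icc (i * (d + 2)) ((i + 1) * (d + 2)),
      q (i + 1) = lam * x v ^ (d + 3) := by
    intro v hv
    rw [show lam * x v ^ (d + 3) = x v * (lam * x v ^ (d + 2)) by ring, ← hev v hv,
      mul_sum_prod_erase]
    exact sum_congr rfl fun i hi => hqi i (mem_range.1 (mem_filter.1 hi).1)
  have hint : ∀ i < n, ∀ r < d + 1, q (i + 1) = lam * x (i * (d + 2) + (r + 1)) ^ (d + 3) := by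
    intro i hi r hr
    rw [← hE _ (by nlinarith), sum_edges_interior (fun j => q (j + 1)) hi (by omega) (by omega)]
  have hjun : ∀ t ≤ n, q t + q (t + 1) = lam * x (t * (d + 2)) ^ (d + 3) := by
    intro t ht
    rw [← hE _ (Nat.mul_le_mul_right _ ht), sum_edges_junction q (by omega) ht hq0 hqn]
  obtain ⟨t, ht, hqt⟩ : ∃ t ≤ n, q t ≠ 0 := by
    by_contra! h
    obtain ⟨v, hv, hxv⟩ := hx
    refine mul_ne_zero hlam (pow_ne_zero (d + 3) hxv) ?_
    rw [← hE v hv]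
    exact sum_eq_zero fun i hi => h _ (mem_range.1 (mem_filter.1 hi).1)
  refine exists_Mpoly_eq_zero_of_recurrence hq0 hqn ht hqt fun i hi => ?_
  have hin : i < n := by
    by_contra hcon
    exact hi (by simp [hq]; omega)
  have hprod : ∏ r ∈ range (d + 1), (lam * x (i * (d + 2) + (r + 1)) ^ (d + 3)) =
      q (i + 1) ^ (d + 1) := by
    rw [prod_congr rfl fun r hr => (hint i hin r (mem_range.1 hr)).symm]
    simp
  rw [prod_mul_distrib, prod_const, card_range, prod_pow] at hprod
  apply mul_left_cancel₀ (pow_ne_zero (d + 1) hi)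
  have hqe := (hqi i hin).trans (prod_Icc_edge d i x)
  rw [hjun i hin.le, hjun (i + 1) hin]
  calc q (i + 1) ^ (d + 1) * (lam ^ (d + 3) * q (i + 1) ^ 2)
      = lam ^ (d + 3) * q (i + 1) ^ (d + 3) := by ring
    _ = _ := by
      conv_lhs => rw [hqe]
      rw [← hprod]
      ring

/-- Deleting a vertex from an edge leaves one of two given vertices. -/
theorem prod_erase_edge_eq_zero {d i v : ℕ} {x : ℕ → ℂ}
    (h₁ : v ≠ i * (d + 2) + 1 → x (i * (d + 2) + 1) = 0)
    (h₂ : v ≠ (i + 1) * (d + 2) → x ((i + 1) * (d + 2)) = 0) :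
    ∏ u ∈ (Icc (i * (d + 2)) ((i + 1) * (d + 2))).erase v, x u = 0 := by
  by_cases hv : v = i * (d + 2) + 1
  · have hne : v ≠ (i + 1) * (d + 2) := by rw [hv]; nlinarith
    exact prod_eq_zero (mem_erase.2 ⟨hne.symm, mem_Icc.2 ⟨by nlinarith, le_rfl⟩⟩) (h₂ hne)
  · exact prod_eq_zero (mem_erase.2 ⟨Ne.symm hv, mem_Icc.2 ⟨by omega, by nlinarith⟩⟩) (h₁ hv)

theorem exists_eigenvector_of_recurrence {d n : ℕ} {lam : ℂ} (hlam : lam ≠ 0) {q : ℕ → ℂ}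
    (h0 : q 0 = 0) (h1 : q 1 ≠ 0) (hn : q (n + 1) = 0)
    (hzero : ∀ i, q (i + 1) = 0 → q (i + 2) = 0)
    (hrec : ∀ i, lam ^ (d + 3) * q (i + 1) ^ 2 = (q i + q (i + 1)) * (q (i + 1) + q (i + 2))) :
    ∃ x : ℕ → ℂ, (∃ v ≤ n * (d + 2), x v ≠ 0) ∧
      ∀ v ≤ n * (d + 2), ∑ i ∈ range n with v ∈ Icc (i * (d + 2)) ((i + 1) * (d + 2)),
        ∏ u ∈ (Icc (i * (d + 2)) ((i + 1) * (d + 2))).erase v, x u = lam * x v ^ (d + 2) := by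
  have hd : 0 < d + 3 := by omega
  choose a ha using fun i => IsAlgClosed.exists_pow_nat_eq (q (i + 1) / lam) hd
  choose b hb using fun t => IsAlgClosed.exists_pow_nat_eq ((q t + q (t + 1)) / lam) hd
  have hcex : ∀ i, ∃ c, c ^ (d + 3) = q (i + 1) / lam ∧
      b i * (c * a i ^ d) * b (i + 1) = q (i + 1) := by
    intro i
    by_cases hq : q (i + 1) = 0
    · exact ⟨0, by simp [hq], by simp [hq]⟩
    · set w := b i * a i ^ (d + 1) * b (i + 1) with hw
      have hwp : w ^ (d + 3) = q (i + 1) ^ (d + 3) := by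
        have : w ^ (d + 3) = b i ^ (d + 3) * (a i ^ (d + 3)) ^ (d + 1) * b (i + 1) ^ (d + 3) := by
          rw [hw]; ring
        rw [this, ha, hb, hb, div_pow]
        field_simp
        rw [← sub_eq_zero]
        linear_combination (-q (i + 1) ^ (d + 1)) * hrec i
      have hw0 : w ≠ 0 := fun h => hq (by
        rw [h, zero_pow hd.ne'] at hwp
        exact pow_eq_zero_iff hd.ne' |>.1 hwp.symm)
      refine ⟨a i * (q (i + 1) / w), ?_, ?_⟩
      · rw [mul_pow, div_pow, hwp, div_self (pow_ne_zero _ hq), mul_one, ha]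
      · rw [show b i * (a i * (q (i + 1) / w) * a i ^ d) * b (i + 1) = w * (q (i + 1) / w) by
          rw [hw]; ring]
        field_simp
  choose c hc hcprod using hcex
  set x : ℕ → ℂ := fun v => if v % (d + 2) = 0 then b (v / (d + 2)) else
    if v % (d + 2) = 1 then c (v / (d + 2)) else a (v / (d + 2)) with hx
  have hxb : ∀ t, x (t * (d + 2)) = b t := fun t => by simp [hx]
  have hxi : ∀ i, ∀ r < d + 1, x (i * (d + 2) + (r + 1)) = if r = 0 then c i else a i := by
    intro i r hr
    have hmod : (i * (d + 2) + (r + 1)) % (d + 2) = r + 1 := by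
      rw [mul_comm, Nat.mul_add_mod, Nat.mod_eq_of_lt (by omega)]
    have hdiv : (i * (d + 2) + (r + 1)) / (d + 2) = i := by
      rw [mul_comm, Nat.mul_add_div (by omega), Nat.div_eq_of_lt (by omega), add_zero]
    simp [hx, hmod, hdiv]
  have hedge : ∀ i, ∏ u ∈ Icc (i * (d + 2)) ((i + 1) * (d + 2)), x u = q (i + 1) := by
    intro i
    rw [prod_Icc_edge, hxb, hxb, prod_congr rfl fun r hr => hxi i r (mem_range.1 hr),
      prod_range_succ', ← hcprod i]
    simp only [Nat.add_eq_zero_iff, one_ne_zero, and_false, if_false, if_true, prod_const,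
      card_range]
    ring
  have hpow : ∀ v ≤ n * (d + 2), ∑ i ∈ range n with v ∈ Icc (i * (d + 2)) ((i + 1) * (d + 2)),
      q (i + 1) = lam * x v ^ (d + 3) := by
    intro v hv
    obtain ⟨t, r, hr, rfl⟩ : ∃ t r, r < d + 2 ∧ v = t * (d + 2) + r :=
      ⟨v / (d + 2), v % (d + 2), Nat.mod_lt _ (by omega), (Nat.div_add_mod' _ _).symm⟩
    rcases r with _ | r
    · have ht : t ≤ n := Nat.le_of_mul_le_mul_right (by simpa using hv) (show 0 < d + 2 by omega)
      rw [add_zero, sum_edges_junction q (by omega) ht h0 hn, hxb, hb]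
      field_simp
    · have ht : t < n := lt_of_mul_lt_mul_right (a := d + 2) (by omega) (Nat.zero_le _)
      rw [sum_edges_interior (fun j => q (j + 1)) ht (by omega) hr, hxi t r (by omega)]
      split_ifs
      · rw [hc]; field_simp
      · rw [ha]; field_simp
  refine ⟨x, ⟨0, Nat.zero_le _, fun h => ?_⟩, fun v hv => ?_⟩
  · have hb0 := hb 0
    rw [← hxb 0, zero_mul, h, zero_pow hd.ne', h0, zero_add, eq_comm, div_eq_zero_iff] at hb0
    exact hb0.elim h1 hlam
  · by_cases hxv : x v = 0
    · rw [hxv, zero_pow (by omega), mul_zero]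
      refine sum_eq_zero fun i hi => ?_
      have hqi : q (i + 1) = 0 := by
        rw [← hedge i]
        exact prod_eq_zero (mem_filter.1 hi).2 hxv
      refine prod_erase_edge_eq_zero (fun _ => ?_) (fun _ => ?_)
      · have h := hxi i 0 (by omega)
        have hci := hc i
        rw [hqi, zero_div, pow_eq_zero_iff hd.ne'] at hci
        simpa [hci] using h
      · have hbi := hb (i + 1)
        rw [hqi, hzero i hqi, add_zero, zero_div, pow_eq_zero_iff hd.ne'] at hbi
        rw [hxb, hbi]
    · apply mul_left_cancel₀ hxv
      rw [mul_sum_prod_erase, sum_congr rfl fun i _ => hedge i, hpow v hv]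
      ring

/-- A complex number `λ` is an eigenvalue of the `k`-uniform hyperpath `P_n^k`
(`k ≥ 3`, `n ≥ 1`) if and only if `λ = 0` or `M_s(λ^k) = 0` for some `1 ≤ s ≤ n`. -/
theorem hyperpath_eigenvalue_iff (k n : ℕ) (hk : 3 ≤ k) (hn : 1 ≤ n) (lam : ℂ) :
    IsEigenvalue k (pathEdges k n) lam ↔
      lam = 0 ∨ ∃ s, 1 ≤ s ∧ s ≤ n ∧ Mpoly s (lam ^ k) = 0 := by
  obtain ⟨d, rfl⟩ : ∃ d, k = d + 3 := ⟨k - 3, by omega⟩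
  rw [isEigenvalue_pathEdges_iff n (by omega)]
  simp only [show d + 3 - 1 = d + 2 from rfl]
  constructor
  · rintro ⟨x, hx, hev⟩
    by_cases hlam : lam = 0
    · exact Or.inl hlam
    · exact Or.inr (exists_Mpoly_eq_zero_of_eigenvector hlam hx hev)
  · intro h
    by_cases hlam : lam = 0
    · subst hlam
      refine ⟨fun v => if v = 0 then 1 else 0, ⟨0, Nat.zero_le _, by simp⟩, fun v _ => ?_⟩
      rw [zero_mul]
      exact sum_eq_zero fun i _ => prod_erase_edge_eq_zero (by simp) (by simp)
    · obtain ⟨s, -, hsn, hM⟩ := h.resolve_left hlam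
      obtain ⟨q, h0, h1, hqn, hzero, hrec⟩ :=
        exists_recurrence_of_Mpoly_eq_zero (pow_ne_zero (d + 3) hlam) hsn hM
      exact exists_eigenvector_of_recurrence hlam h0 h1 hqn hzero hrec
end

section
/- Let k ≥ 3 and m ≥ 1. A complex number λ is an eigenvalue of the k-uniform hyperstar S_m^k if and only if λ = 0 or λ^k = p for some integer p with 1 ≤ p ≤ m. -/
open Finset

/-- The edge `e_i = {w} ∪ {(i, j) : j ∈ {1,…,k-1}}` of the hyperstar `S_m^k`.
Here `none` is the centre `w` and `some (i, j)` is the vertex `(i, j+1)`. -/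
def hyperstarEdge (m k : ℕ) (i : Fin m) : Finset (Option (Fin m × Fin (k - 1))) :=
  insert none ((Finset.univ.filter (fun p : Fin m × Fin (k - 1) => p.1 = i)).image some)

/-- The edge set of the `k`-uniform hyperstar `S_m^k` with `m` edges. -/
def hyperstarEdges (m k : ℕ) : Finset (Finset (Option (Fin m × Fin (k - 1)))) :=
  Finset.univ.image (hyperstarEdge m k)

theorem hyperstarEdge_eq_insert_image (m k : ℕ) (i : Fin m) :
    hyperstarEdge m k i = insert none (univ.image fun j => some (i, j)) := by
  ext v
  rcases v with _ | ⟨a, b⟩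
  · simp [hyperstarEdge]
  · simp [hyperstarEdge, eq_comm]

theorem some_mem_hyperstarEdge {m k : ℕ} {i a : Fin m} {b : Fin (k - 1)} :
    some (a, b) ∈ hyperstarEdge m k i ↔ a = i := by
  simp [hyperstarEdge]

theorem hyperstarEdge_injective (m : ℕ) {k : ℕ} (hk : 2 ≤ k) :
    Function.Injective (hyperstarEdge m k) := by
  intro a b hab
  have h : some (a, (⟨0, by omega⟩ : Fin (k - 1))) ∈ hyperstarEdge m k a :=
    some_mem_hyperstarEdge.2 rfl
  rw [hab] at h
  exact some_mem_hyperstarEdge.1 h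

theorem prod_hyperstarEdge_erase_none {m k : ℕ} (i : Fin m)
    (x : Option (Fin m × Fin (k - 1)) → ℂ) :
    ∏ u ∈ (hyperstarEdge m k i).erase none, x u = ∏ j, x (some (i, j)) := by
  rw [hyperstarEdge_eq_insert_image, erase_insert (by simp), prod_image]
  intro a _ b _ h
  simpa using h

theorem prod_hyperstarEdge_erase_some {m k : ℕ} (i : Fin m) (j : Fin (k - 1))
    (x : Option (Fin m × Fin (k - 1)) → ℂ) :
    ∏ u ∈ (hyperstarEdge m k i).erase (some (i, j)), x u =
      x none * ∏ l ∈ univ.erase j, x (some (i, l)) := by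
  have h : (hyperstarEdge m k i).erase (some (i, j)) =
      insert none ((univ.erase j).image fun l => some (i, l)) := by
    ext v
    rcases v with _ | ⟨a, b⟩
    · simp [hyperstarEdge]
    · simp only [mem_erase, some_mem_hyperstarEdge, mem_insert, mem_image, mem_univ]
      grind
  rw [h, prod_insert (by simp), prod_image]
  intro a _ b _ h
  simpa using h

/-- The eigenvalue equations of the hyperstar, at the centre and at the other vertices. -/
theorem isEigenvalue_hyperstarEdges_iff (m : ℕ) {k : ℕ} (hk : 2 ≤ k) (lam : ℂ) :
    IsEigenvalue k (hyperstarEdges m k) lam ↔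
      ∃ x : Option (Fin m × Fin (k - 1)) → ℂ, x ≠ 0 ∧
        ∑ i, ∏ j, x (some (i, j)) = lam * x none ^ (k - 1) ∧
        ∀ i j, x none * ∏ l ∈ univ.erase j, x (some (i, l)) =
          lam * x (some (i, j)) ^ (k - 1) := by
  have centre : (hyperstarEdges m k).filter (fun e => none ∈ e) =
      univ.image (hyperstarEdge m k) := by
    refine filter_true_of_mem fun e he => ?_
    obtain ⟨i, -, rfl⟩ := mem_image.1 he
    simp [hyperstarEdge]
  have leaf (i : Fin m) (j : Fin (k - 1)) :
      (hyperstarEdges m k).filter (fun e => some (i, j) ∈ e) = {hyperstarEdge m k i} := by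
    ext e
    simp only [hyperstarEdges, mem_filter, mem_image, mem_univ, true_and, mem_singleton]
    constructor
    · rintro ⟨⟨a, rfl⟩, h⟩
      rw [some_mem_hyperstarEdge.1 h]
    · rintro rfl
      exact ⟨⟨i, rfl⟩, some_mem_hyperstarEdge.2 rfl⟩
  refine exists_congr fun x => and_congr_right fun _ => ?_
  rw [Option.forall, Prod.forall, centre, sum_image (hyperstarEdge_injective m hk).injOn]
  simp only [prod_hyperstarEdge_erase_none, leaf, sum_singleton, prod_hyperstarEdge_erase_some]

/-- If every entry of a nowhere-zero vector `y` of length `n` satisfies the leaf equation, then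
the product of the entries is determined by the centre value `w`. -/
theorem prod_eq_of_leaf_equations {n : ℕ} {w lam : ℂ} (y : Fin n → ℂ)
    (hy : ∏ j, y j ≠ 0) (h : ∀ j, w * ∏ l ∈ univ.erase j, y l = lam * y j ^ n) :
    lam ^ n * ∏ j, y j = w ^ n := by
  have hj (j : Fin n) : w * ∏ l, y l = lam * y j ^ (n + 1) := by
    rw [← mul_prod_erase univ y (mem_univ j)]
    linear_combination y j * h j
  have hprod : ∏ _j : Fin n, (w * ∏ l, y l) = ∏ j, lam * y j ^ (n + 1) :=
    prod_congr rfl fun j _ => hj j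
  simp only [prod_mul_distrib, prod_pow, prod_const, card_univ, Fintype.card_fin] at hprod
  refine mul_right_cancel₀ (pow_ne_zero n hy) ?_
  linear_combination -hprod

theorem exists_nat_pow_eq_of_hyperstar_equations {m n : ℕ} {lam w : ℂ}
    (hlam : lam ≠ 0) (hw : w ≠ 0) (y : Fin m → Fin n → ℂ)
    (hcentre : ∑ i, ∏ j, y i j = lam * w ^ n)
    (hleaf : ∀ i j, w * ∏ l ∈ univ.erase j, y i l = lam * y i j ^ n) :
    ∃ p : ℕ, 1 ≤ p ∧ p ≤ m ∧ lam ^ (n + 1) = (p : ℂ) := by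
  have hp : lam ^ (n + 1) = ((univ.filter fun i => ∏ j, y i j ≠ 0).card : ℂ) := by
    have hterm (i : Fin m) :
        lam ^ n * ∏ j, y i j = if ∏ j, y i j ≠ 0 then w ^ n else 0 := by
      split_ifs with h
      · exact prod_eq_of_leaf_equations (y i) h (hleaf i)
      · rw [not_not.1 h, mul_zero]
    have hsum : lam ^ n * ∑ i, ∏ j, y i j =
        (univ.filter fun i => ∏ j, y i j ≠ 0).card * w ^ n := by
      rw [mul_sum, sum_congr rfl fun i _ => hterm i, ← sum_filter, sum_const, nsmul_eq_mul]
    refine mul_right_cancel₀ (pow_ne_zero n hw) ?_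
    rw [← hsum, hcentre]
    ring
  refine ⟨_, ?_, (card_le_univ _).trans_eq (Fintype.card_fin m), hp⟩
  rw [Nat.one_le_iff_ne_zero]
  intro h0
  rw [h0, Nat.cast_zero] at hp
  exact pow_ne_zero _ hlam hp

/-- A complex number `λ` is an eigenvalue of the `k`-uniform hyperstar `S_m^k`
(`k ≥ 3`, `m ≥ 1`) iff `λ = 0` or `λ^k = p` for some integer `1 ≤ p ≤ m`. -/
theorem hyperstar_eigenvalue_iff (k m : ℕ) (hk : 3 ≤ k) (hm : 1 ≤ m) (lam : ℂ) :
    IsEigenvalue k (hyperstarEdges m k) lam ↔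
      lam = 0 ∨ ∃ p : ℕ, 1 ≤ p ∧ p ≤ m ∧ lam ^ k = (p : ℂ) := by
  rw [isEigenvalue_hyperstarEdges_iff m (by omega)]
  obtain ⟨n, rfl⟩ : ∃ n, k = n + 1 := ⟨k - 1, by omega⟩
  simp only [Nat.add_sub_cancel]
  have hn : n ≠ 0 := by omega
  have erase_nonempty (j : Fin n) : (univ.erase j).Nonempty := by
    rw [← card_pos, card_erase_of_mem (mem_univ j), card_univ, Fintype.card_fin]
    omega
  constructor
  · rintro ⟨x, hx, hcentre, hleaf⟩
    refine or_iff_not_imp_left.2 fun hlam => ?_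
    have hw : x none ≠ 0 := by
      intro hw
      refine hx (funext fun v => ?_)
      rcases v with _ | ⟨i, j⟩
      · exact hw
      · have h := hleaf i j
        rw [hw, zero_mul, eq_comm, mul_eq_zero] at h
        exact eq_zero_of_pow_eq_zero (h.resolve_left hlam)
    exact exists_nat_pow_eq_of_hyperstar_equations hlam hw (fun i j => x (some (i, j)))
      hcentre hleaf
  · rintro (rfl | ⟨p, hp, hpm, hlam⟩)
    · refine ⟨Pi.single none 1, by simp, ?_, fun i j => ?_⟩
      · simp [hn]
      · simp only [Pi.single_eq_of_ne (Option.some_ne_none _), prod_const]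
        rw [zero_pow (card_ne_zero.2 (erase_nonempty j)), mul_zero, zero_mul]
    · have hlam0 : lam ≠ 0 := by
        rintro rfl
        rw [zero_pow n.succ_ne_zero, eq_comm, Nat.cast_eq_zero] at hlam
        omega
      obtain ⟨c, hc⟩ : ∃ c : Fin m → ℂ, ∀ i, c i = if (i : ℕ) < p then 1 else 0 :=
        ⟨_, fun _ => rfl⟩
      refine ⟨fun v => v.elim lam fun q => c q.1,
        fun h => hlam0 (congrFun h none), ?_, fun i (j : Fin n) => ?_⟩
      · have hcard : (univ.filter fun i : Fin m => (i : ℕ) < p).card = p := by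
          rw [Fin.card_filter_val_lt, min_eq_right hpm]
        change ∑ i, ∏ _j : Fin n, c i = lam * lam ^ n
        simp only [prod_const, card_univ, Fintype.card_fin, hc, ite_pow, one_pow, zero_pow hn,
          sum_boole, hcard]
        rw [← hlam, pow_succ']
      · change lam * ∏ _l ∈ univ.erase j, c i = lam * c i ^ n
        simp only [prod_const, hc, ite_pow, one_pow, zero_pow hn,
          zero_pow (card_ne_zero.2 (erase_nonempty j))]
end

section
/- Let k ≥ 3. A complex number λ is an eigenvalue of the k-uniform hyperpath P_2^k with two edges (equivalently, of the k-uniform hyperstar with two edges) if and only if λ = 0, λ^k = 1, or λ^k = 2. -/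
open Finset

/-- The eigenvalue equations of the hyperstar with centre `c` and two edges
`insert c A` and `insert c B`. -/
lemma isEigenvalue_pair_iff {V : Type*} [Fintype V] [DecidableEq V] {k : ℕ} {c : V}
    {A B : Finset V} (hcA : c ∉ A) (hcB : c ∉ B) (hAB : Disjoint A B) (hA : A.Nonempty)
    (hcover : ∀ v, v = c ∨ v ∈ A ∨ v ∈ B) (lam : ℂ) :
    IsEigenvalue k {insert c A, insert c B} lam ↔
      ∃ x : V → ℂ, x ≠ 0 ∧ ∏ u ∈ A, x u + ∏ u ∈ B, x u = lam * x c ^ (k - 1) ∧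
        (∀ v ∈ A, x c * ∏ u ∈ A.erase v, x u = lam * x v ^ (k - 1)) ∧
        ∀ v ∈ B, x c * ∏ u ∈ B.erase v, x u = lam * x v ^ (k - 1) := by
  have hne : insert c A ≠ insert c B := by
    obtain ⟨a, ha⟩ := hA
    intro h
    have haB : a ∈ insert c B := h ▸ mem_insert_of_mem ha
    rcases mem_insert.1 haB with rfl | haB
    · exact hcA ha
    · exact disjoint_left.1 hAB ha haB
  have center (x : V → ℂ) :
      ∑ e ∈ ({insert c A, insert c B} : Finset (Finset V)).filter (fun e => c ∈ e),
        ∏ u ∈ e.erase c, x u = ∏ u ∈ A, x u + ∏ u ∈ B, x u := by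
    rw [filter_true_of_mem (by simp), sum_pair hne, erase_insert hcA, erase_insert hcB]
  have leafA (x : V → ℂ) (v : V) (hv : v ∈ A) :
      ∑ e ∈ ({insert c A, insert c B} : Finset (Finset V)).filter (fun e => v ∈ e),
        ∏ u ∈ e.erase v, x u = x c * ∏ u ∈ A.erase v, x u := by
    have hvc : v ≠ c := fun h => hcA (h ▸ hv)
    have hvB : v ∉ B := disjoint_left.1 hAB hv
    rw [filter_insert, filter_singleton, if_pos (mem_insert_of_mem hv),
      if_neg (by simp [hvc, hvB]), insert_empty_eq, sum_singleton,
      erase_insert_of_ne hvc.symm, prod_insert (fun h => hcA (mem_of_mem_erase h))]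
  have leafB (x : V → ℂ) (v : V) (hv : v ∈ B) :
      ∑ e ∈ ({insert c A, insert c B} : Finset (Finset V)).filter (fun e => v ∈ e),
        ∏ u ∈ e.erase v, x u = x c * ∏ u ∈ B.erase v, x u := by
    have hvc : v ≠ c := fun h => hcB (h ▸ hv)
    have hvA : v ∉ A := disjoint_right.1 hAB hv
    rw [filter_insert, filter_singleton, if_pos (mem_insert_of_mem hv),
      if_neg (by simp [hvc, hvA]), sum_singleton,
      erase_insert_of_ne hvc.symm, prod_insert (fun h => hcB (mem_of_mem_erase h))]
  refine exists_congr fun x => and_congr_right fun _ => ⟨fun h => ⟨?_, ?_, ?_⟩, ?_⟩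
  · rw [← center, h]
  · intro v hv
    rw [← leafA x v hv, h]
  · intro v hv
    rw [← leafB x v hv, h]
  · rintro ⟨hc, h₁, h₂⟩ v
    rcases hcover v with rfl | hv | hv
    · rw [center, hc]
    · rw [leafA x v hv, h₁ v hv]
    · rw [leafB x v hv, h₂ v hv]

/-- If `λ ≠ 0`, an eigenvector restricted to the leaves `A` of an edge of a hyperstar either
vanishes or has its product over `A` determined by the value `y` at the centre. -/
lemma leaves_eq_zero_or_prod_eq {V : Type*} [DecidableEq V] {m : ℕ} {A : Finset V}
    (hA : A.card = m) {lam y : ℂ} (hlam : lam ≠ 0) {x : V → ℂ}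
    (h : ∀ v ∈ A, y * ∏ u ∈ A.erase v, x u = lam * x v ^ m) :
    (∀ v ∈ A, x v = 0) ∨ y ≠ 0 ∧ lam ^ m * ∏ u ∈ A, x u = y ^ m := by
  have hpow : ∀ v ∈ A, lam * x v ^ (m + 1) = y * ∏ u ∈ A, x u := by
    intro v hv
    rw [← mul_prod_erase A x hv, pow_succ, ← mul_assoc, ← h v hv]
    ring
  by_cases hzero : y * ∏ u ∈ A, x u = 0
  · left
    intro v hv
    have := hpow v hv
    rw [hzero] at this
    simpa [hlam] using this
  · right
    have hy : y ≠ 0 := left_ne_zero_of_mul hzero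
    have hP : ∏ u ∈ A, x u ≠ 0 := right_ne_zero_of_mul hzero
    refine ⟨hy, ?_⟩
    have hprod := prod_congr rfl hpow
    rw [prod_mul_distrib, prod_const, prod_const, prod_pow, hA, mul_pow, pow_succ] at hprod
    refine mul_right_cancel₀ (pow_ne_zero m hP) ?_
    rw [← hprod]
    ring

/-- The eigenvalues of the hyperstar with two edges `insert c A` and `insert c B`. -/
theorem hyperstar_two_edges_eigenvalue_iff {V : Type*} [Fintype V] [DecidableEq V] {k : ℕ}
    (hk : 3 ≤ k) {c : V} {A B : Finset V} (hcA : c ∉ A) (hcB : c ∉ B) (hAB : Disjoint A B)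
    (hA : A.card = k - 1) (hB : B.card = k - 1) (hcover : ∀ v, v = c ∨ v ∈ A ∨ v ∈ B)
    (lam : ℂ) :
    IsEigenvalue k {insert c A, insert c B} lam ↔
      lam = 0 ∨ lam ^ k = 1 ∨ lam ^ k = 2 := by
  obtain ⟨m, rfl⟩ : ∃ m, k = m + 1 := ⟨k - 1, by omega⟩
  rw [Nat.add_sub_cancel] at hA hB
  have hm : m ≠ 0 := by omega
  have hAne : A.Nonempty := card_pos.1 (by omega)
  have hBne : B.Nonempty := card_pos.1 (by omega)
  rw [isEigenvalue_pair_iff hcA hcB hAB hAne hcover, Nat.add_sub_cancel]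
  constructor
  · rintro ⟨x, hx, hc, h₁, h₂⟩
    rw [or_iff_not_imp_left]
    intro hlam
    have key {s : ℂ} (hy : x c ≠ 0)
        (hs : lam ^ m * (∏ u ∈ A, x u + ∏ u ∈ B, x u) = s * x c ^ m) : lam ^ (m + 1) = s := by
      refine mul_right_cancel₀ (pow_ne_zero m hy) ?_
      rw [← hs, hc]
      ring
    rcases leaves_eq_zero_or_prod_eq hA hlam h₁ with hA0 | ⟨hy, hPA⟩ <;>
      rcases leaves_eq_zero_or_prod_eq hB hlam h₂ with hB0 | ⟨hy, hPB⟩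
    · refine absurd (funext fun v => ?_) hx
      obtain ⟨a, ha⟩ := hAne
      obtain ⟨b, hb⟩ := hBne
      rw [prod_eq_zero ha (hA0 a ha), prod_eq_zero hb (hB0 b hb)] at hc
      rcases hcover v with rfl | hv | hv
      · simpa [hlam, hm, eq_comm] using hc
      · exact hA0 v hv
      · exact hB0 v hv
    · obtain ⟨a, ha⟩ := hAne
      refine Or.inl (key hy ?_)
      rw [prod_eq_zero ha (hA0 a ha), zero_add, hPB, one_mul]
    · obtain ⟨b, hb⟩ := hBne
      refine Or.inl (key hy ?_)
      rw [prod_eq_zero hb (hB0 b hb), add_zero, hPA, one_mul]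
    · refine Or.inr (key hy ?_)
      rw [mul_add, hPA, hPB, two_mul]
  · intro h
    have hcardA : ∀ v ∈ A, (A.erase v).Nonempty := fun v hv =>
      card_pos.1 (by rw [card_erase_of_mem hv]; omega)
    have hcardB : ∀ v ∈ B, (B.erase v).Nonempty := fun v hv =>
      card_pos.1 (by rw [card_erase_of_mem hv]; omega)
    rcases h with rfl | h
    · have hzero (S : Finset V) (hcS : c ∉ S) (hS : S.Nonempty) :
          ∏ u ∈ S, (Pi.single c 1 : V → ℂ) u = 0 := by
        obtain ⟨s, hs⟩ := hS
        exact prod_eq_zero hs (Pi.single_eq_of_ne (ne_of_mem_of_not_mem hs hcS) _)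
      refine ⟨Pi.single c 1, by simp, ?_, ?_, ?_⟩
      · rw [hzero A hcA hAne, hzero B hcB hBne]
        simp
      · intro v hv
        rw [hzero _ (fun e => hcA (mem_of_mem_erase e)) (hcardA v hv)]
        simp
      · intro v hv
        rw [hzero _ (fun e => hcB (mem_of_mem_erase e)) (hcardB v hv)]
        simp
    · obtain ⟨b, hb, hlb⟩ : ∃ b : ℂ, (b = 0 ∨ b = 1) ∧ lam ^ (m + 1) = 1 + b := by
        rcases h with h | h
        · exact ⟨0, Or.inl rfl, by simpa using h⟩
        · exact ⟨1, Or.inr rfl, by rw [h]; norm_num⟩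
      have hpow (n : ℕ) (hn : n ≠ 0) : b ^ n = b := by
        rcases hb with rfl | rfl <;> simp [hn]
      let x : V → ℂ := fun v => if v = c then lam else if v ∈ A then 1 else b
      have hxc : x c = lam := if_pos rfl
      have hxA : ∀ v ∈ A, x v = 1 := fun v hv => by
        simp [x, hv, show v ≠ c from fun e => hcA (e ▸ hv)]
      have hxB : ∀ v ∈ B, x v = b := fun v hv => by
        simp [x, disjoint_right.1 hAB hv, show v ≠ c from fun e => hcB (e ▸ hv)]
      refine ⟨x, ?_, ?_, ?_, ?_⟩
      · obtain ⟨a, ha⟩ := hAne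
        exact fun e => one_ne_zero ((hxA a ha).symm.trans (congrFun e a))
      · rw [prod_congr rfl hxA, prod_congr rfl hxB, prod_const, prod_const, one_pow, hB,
          hpow m hm, hxc, ← hlb, pow_succ']
      · intro v hv
        rw [prod_congr rfl fun u hu => hxA u (mem_of_mem_erase hu), hxA v hv, hxc]
        simp
      · intro v hv
        rw [prod_congr rfl fun u hu => hxB u (mem_of_mem_erase hu), hxB v hv, hxc, prod_const,
          hpow _ (card_pos.2 (hcardB v hv)).ne', hpow m hm]

/-- The hyperpath with two edges is the hyperstar centred at the vertex `k - 1`. -/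
lemma pathEdges_two (k : ℕ) (c : Fin (2 * (k - 1) + 1)) (hc : c.val = k - 1) :
    pathEdges k 2 = {insert c (Iio c), insert c (Ioi c)} := by
  have h₁ : pathEdge k 1 (2 * (k - 1) + 1) = Iic c := by
    ext v
    simp [pathEdge, Fin.le_def, hc]
  have h₂ : pathEdge k 2 (2 * (k - 1) + 1) = Ici c := by
    ext v
    simp only [pathEdge, mem_filter, mem_univ, true_and, mem_Ici, Fin.le_def, hc]
    omega
  rw [pathEdges, show Icc 1 2 = ({1, 2} : Finset ℕ) from rfl, image_insert, image_singleton,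
    h₁, h₂, Iio_insert, Ioi_insert]

/-- For `k ≥ 3`, a complex number `λ` is an eigenvalue of the `k`-uniform
hyperpath `P_2^k` with two edges (equivalently, of the hyperstar with two edges)
iff `λ = 0`, `λ^k = 1`, or `λ^k = 2`. -/
theorem hyperpath_two_edges_eigenvalue_iff (k : ℕ) (hk : 3 ≤ k) (lam : ℂ) :
    IsEigenvalue k (pathEdges k 2) lam ↔
      lam = 0 ∨ lam ^ k = 1 ∨ lam ^ k = 2 := by
  let c : Fin (2 * (k - 1) + 1) := ⟨k - 1, by omega⟩
  rw [pathEdges_two k c rfl]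
  refine hyperstar_two_edges_eigenvalue_iff hk (by simp) (by simp) ?_ ?_ ?_ ?_ lam
  · exact disjoint_left.2 fun v h₁ h₂ => lt_asymm (mem_Iio.1 h₁) (mem_Ioi.1 h₂)
  · rw [Fin.card_Iio]
  · rw [Fin.card_Ioi]
    simp only [c]
    omega
  · intro v
    rcases lt_trichotomy v c with h | h | h
    · exact Or.inr (Or.inl (mem_Iio.2 h))
    · exact Or.inl h
    · exact Or.inr (Or.inr (mem_Ioi.2 h))
end

section
/- Let k ≥ 3. A complex number λ is an eigenvalue of the k-uniform starlike hypergraph S^k_{1,1,2} if and only if λ = 0, λ^k ∈ {1, 2, 3}, λ^{2k} − 3λ^k + 1 = 0, or λ^{2k} − 4λ^k + 2 = 0. -/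
open Finset

/-- The vertex type of the starlike hypergraph `S^k_{n_1,…,n_m}`:
`none` is the common vertex `w`, and `some ⟨i, u⟩` is the vertex `(i, u+1)`. -/
abbrev StarVertex (k m : ℕ) (n : Fin m → ℕ) : Type :=
  Option ((i : Fin m) × Fin (n i * (k - 1)))

/-- The edge `e_{i,t}` of the starlike hypergraph: it consists of the vertices
`(i, v)` with `(t-1)(k-1) ≤ v ≤ t(k-1)`, where `(i, 0)` is the common vertex `w`
(so `w ∈ e_{i,t}` exactly when `t = 1`). -/
def starEdge (k : ℕ) {m : ℕ} (n : Fin m → ℕ) (i : Fin m) (t : ℕ) :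
    Finset (StarVertex k m n) :=
  ((Finset.univ.filter (fun p : (j : Fin m) × Fin (n j * (k - 1)) =>
      p.1 = i ∧ (t - 1) * (k - 1) ≤ p.2.val + 1 ∧ p.2.val + 1 ≤ t * (k - 1))).image some)
    ∪ (if t = 1 then {none} else ∅)

/-- The edge set of the starlike hypergraph `S^k_{n_1,…,n_m}`. -/
def starEdges (k : ℕ) {m : ℕ} (n : Fin m → ℕ) :
    Finset (Finset (StarVertex k m n)) :=
  Finset.univ.biUnion (fun i : Fin m => (Finset.Icc 1 (n i)).image (starEdge k n i))

/-- Four `k`-sets on a vertex type arranged as the edges of `S^k_{1,1,2}`: `A`, `B`, `C` share the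
vertex `w`, the sets `C` and `D` share the vertex `d`, and there are no further incidences. -/
structure IsStar112 {V : Type*} (k : ℕ) (A B C D : Finset V) (w d : V) : Prop where
  card_A : A.card = k
  card_B : B.card = k
  card_C : C.card = k
  card_D : D.card = k
  w_mem_A : w ∈ A
  w_mem_B : w ∈ B
  w_mem_C : w ∈ C
  w_notMem_D : w ∉ D
  d_notMem_A : d ∉ A
  d_notMem_B : d ∉ B
  d_mem_C : d ∈ C
  d_mem_D : d ∈ D
  eq_of_AB : ∀ v, v ∈ A → v ∈ B → v = w
  eq_of_AC : ∀ v, v ∈ A → v ∈ C → v = w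
  eq_of_BC : ∀ v, v ∈ B → v ∈ C → v = w
  disj_AD : ∀ v, v ∈ A → v ∉ D
  disj_BD : ∀ v, v ∈ B → v ∉ D
  eq_of_CD : ∀ v, v ∈ C → v ∈ D → v = d
  cover : ∀ v, v ∈ A ∨ v ∈ B ∨ v ∈ C ∨ v ∈ D

/-- If every vertex of `T ⊆ S` satisfies the eigenvalue equation of a vertex of degree one in the
edge `S`, the product over the edge is determined by the vertices outside `T`. -/
theorem edge_prod_relation {V : Type*} [DecidableEq V] {k : ℕ} {lam : ℂ} {x : V → ℂ}
    {S T : Finset V} (hTS : T ⊆ S) (h : ∀ v ∈ T, ∏ u ∈ S, x u = lam * x v ^ k) :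
    lam ^ T.card * (∏ u ∈ S, x u) ^ k =
      (∏ u ∈ S \ T, x u) ^ k * (∏ u ∈ S, x u) ^ T.card := by
  have hT : (∏ u ∈ S, x u) ^ T.card = lam ^ T.card * (∏ u ∈ T, x u) ^ k := by
    rw [← prod_const, prod_congr rfl h, prod_mul_distrib, prod_const, prod_pow]
  rw [hT, ← prod_sdiff hTS, mul_pow]
  ring

theorem pendant_edge_prod {V : Type*} [DecidableEq V] {k : ℕ} {lam : ℂ} {x : V → ℂ}
    {S : Finset V} {w : V} (hk : 3 ≤ k) (hS : S.card = k) (hw : w ∈ S)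
    (h : ∀ v ∈ S, v ≠ w → ∏ u ∈ S, x u = lam * x v ^ k) :
    ∏ u ∈ S, x u = 0 ∨ lam ^ (k - 1) * ∏ u ∈ S, x u = x w ^ k := by
  have hr := edge_prod_relation (erase_subset w S)
    (fun v hv => h v (mem_of_mem_erase hv) (ne_of_mem_erase hv))
  rw [card_erase_of_mem hw, hS, sdiff_erase_self hw, prod_singleton] at hr
  refine or_iff_not_imp_left.2 fun h0 => mul_right_cancel₀ (pow_ne_zero (k - 1) h0) ?_
  rw [← hr, mul_assoc, ← pow_succ', Nat.sub_add_cancel (by omega)]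

theorem connecting_edge_prod {V : Type*} [DecidableEq V] {k : ℕ} {lam : ℂ} {x : V → ℂ}
    {S : Finset V} {w d : V} (hk : 3 ≤ k) (hS : S.card = k) (hw : w ∈ S) (hd : d ∈ S)
    (hwd : d ≠ w) (h : ∀ v ∈ S, v ≠ w → v ≠ d → ∏ u ∈ S, x u = lam * x v ^ k) :
    ∏ u ∈ S, x u = 0 ∨ lam ^ (k - 2) * (∏ u ∈ S, x u) ^ 2 = x w ^ k * x d ^ k := by
  have hd' : d ∈ S.erase w := mem_erase.2 ⟨hwd, hd⟩
  have hr := edge_prod_relation (((S.erase w).erase_subset d).trans (erase_subset w S))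
    (fun v hv => h v (mem_of_mem_erase (mem_of_mem_erase hv))
      (ne_of_mem_erase (mem_of_mem_erase hv)) (ne_of_mem_erase hv))
  have hs : S \ ((S.erase w).erase d) = {w, d} := by
    ext u
    simp only [mem_sdiff, mem_erase, mem_insert, mem_singleton]
    grind
  rw [card_erase_of_mem hd', card_erase_of_mem hw, hS, hs, prod_pair hwd.symm, mul_pow,
    Nat.sub_sub] at hr
  refine or_iff_not_imp_left.2 fun h0 => mul_right_cancel₀ (pow_ne_zero (k - 2) h0) ?_
  rw [← hr, mul_assoc, ← pow_add]
  congr 3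
  omega

namespace IsStar112

variable {V : Type*} {k : ℕ} {A B C D : Finset V} {w d : V}

theorem d_ne_w (H : IsStar112 k A B C D w d) : d ≠ w :=
  fun h => H.d_notMem_A (h ▸ H.w_mem_A)

variable [DecidableEq V]

theorem sum_filter_mem (H : IsStar112 k A B C D w d) (hk : 3 ≤ k) (f : Finset V → ℂ) (v : V) :
    ∑ e ∈ ({A, B, C, D} : Finset (Finset V)).filter (fun e => v ∈ e), f e =
      (if v ∈ A then f A else 0) + ((if v ∈ B then f B else 0) +
        ((if v ∈ C then f C else 0) + (if v ∈ D then f D else 0))) := by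
  have hAB : A ≠ B := by
    rintro rfl
    have hsub : A ⊆ {w} := fun v hv => mem_singleton.2 (H.eq_of_AB v hv hv)
    have hcard := card_le_card hsub
    rw [H.card_A, card_singleton] at hcard
    omega
  have hAC : A ≠ C := fun h => H.d_notMem_A (h ▸ H.d_mem_C)
  have hAD : A ≠ D := fun h => H.d_notMem_A (h ▸ H.d_mem_D)
  have hBC : B ≠ C := fun h => H.d_notMem_B (h ▸ H.d_mem_C)
  have hBD : B ≠ D := fun h => H.d_notMem_B (h ▸ H.d_mem_D)
  have hCD : C ≠ D := fun h => H.w_notMem_D (h ▸ H.w_mem_C)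
  rw [sum_filter, sum_insert (by simp [hAB, hAC, hAD]), sum_insert (by simp [hBC, hBD]),
    sum_insert (by simp [hCD]), sum_singleton]

variable [Fintype V]

/-- The values of `λ ^ k` for an eigenvalue `λ ≠ 0`. -/
theorem pow_of_isEigenvalue (H : IsStar112 k A B C D w d) (hk : 3 ≤ k) {lam : ℂ}
    (hlam : lam ≠ 0) (hE : IsEigenvalue k {A, B, C, D} lam) :
    lam ^ k = 1 ∨ lam ^ k = 2 ∨ lam ^ k = 3 ∨
      (lam ^ k) ^ 2 - 3 * lam ^ k + 1 = 0 ∨ (lam ^ k) ^ 2 - 4 * lam ^ k + 2 = 0 := by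
  obtain ⟨x, hx0, hx⟩ := hE
  have hx' : ∀ v, (if v ∈ A then ∏ u ∈ A, x u else 0) + ((if v ∈ B then ∏ u ∈ B, x u else 0) +
      ((if v ∈ C then ∏ u ∈ C, x u else 0) + (if v ∈ D then ∏ u ∈ D, x u else 0))) =
      lam * x v ^ k := by
    intro v
    rw [← H.sum_filter_mem hk (fun e => ∏ u ∈ e, x u) v]
    have hpow : x v ^ k = x v * x v ^ (k - 1) := by
      rw [← pow_succ', Nat.sub_add_cancel (by omega)]
    rw [hpow, mul_left_comm, ← hx v, mul_sum]
    exact sum_congr rfl fun e he => (mul_prod_erase e x (mem_filter.1 he).2).symm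
  have hA : ∀ v ∈ A, v ≠ w → ∏ u ∈ A, x u = lam * x v ^ k := by
    intro v hv hvw
    have hB' : v ∉ B := fun h => hvw (H.eq_of_AB v hv h)
    have hC' : v ∉ C := fun h => hvw (H.eq_of_AC v hv h)
    simpa [hv, hB', hC', H.disj_AD v hv] using hx' v
  have hB : ∀ v ∈ B, v ≠ w → ∏ u ∈ B, x u = lam * x v ^ k := by
    intro v hv hvw
    have hA' : v ∉ A := fun h => hvw (H.eq_of_AB v h hv)
    have hC' : v ∉ C := fun h => hvw (H.eq_of_BC v hv h)
    simpa [hv, hA', hC', H.disj_BD v hv] using hx' v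
  have hC : ∀ v ∈ C, v ≠ w → v ≠ d → ∏ u ∈ C, x u = lam * x v ^ k := by
    intro v hv hvw hvd
    have hA' : v ∉ A := fun h => hvw (H.eq_of_AC v h hv)
    have hB' : v ∉ B := fun h => hvw (H.eq_of_BC v h hv)
    have hD' : v ∉ D := fun h => hvd (H.eq_of_CD v hv h)
    simpa [hv, hA', hB', hD'] using hx' v
  have hD : ∀ v ∈ D, v ≠ d → ∏ u ∈ D, x u = lam * x v ^ k := by
    intro v hv hvd
    have hA' : v ∉ A := fun h => H.disj_AD v h hv
    have hB' : v ∉ B := fun h => H.disj_BD v h hv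
    have hC' : v ∉ C := fun h => hvd (H.eq_of_CD v h hv)
    simpa [hv, hA', hB', hC'] using hx' v
  have hw := hx' w
  have hd := hx' d
  simp only [H.w_mem_A, H.w_mem_B, H.w_mem_C, H.w_notMem_D, H.d_notMem_A, H.d_notMem_B,
    H.d_mem_C, H.d_mem_D, if_true, if_false, add_zero, zero_add] at hw hd
  have eA := pendant_edge_prod hk H.card_A H.w_mem_A hA
  have eB := pendant_edge_prod hk H.card_B H.w_mem_B hB
  have eD := pendant_edge_prod hk H.card_D H.d_mem_D hD
  have eC := connecting_edge_prod hk H.card_C H.w_mem_C H.d_mem_C H.d_ne_w hC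
  have hne : ¬ (x w ^ k = 0 ∧ x d ^ k = 0) := by
    rintro ⟨hw0, hd0⟩
    have hk0 : k ≠ 0 := by omega
    have hw1 : x w = 0 := pow_eq_zero_iff hk0 |>.1 hw0
    have hd1 : x d = 0 := pow_eq_zero_iff hk0 |>.1 hd0
    have key : ∀ v, lam * x v ^ k = 0 → x v = 0 := fun v hv =>
      pow_eq_zero_iff hk0 |>.1 ((mul_eq_zero.1 hv).resolve_left hlam)
    refine hx0 (funext fun v => ?_)
    by_cases hvw : v = w
    · rw [hvw, hw1]; rfl
    by_cases hvd : v = d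
    · rw [hvd, hd1]; rfl
    rcases H.cover v with hv | hv | hv | hv
    · exact key v (by rw [← hA v hv hvw, prod_eq_zero H.w_mem_A hw1])
    · exact key v (by rw [← hB v hv hvw, prod_eq_zero H.w_mem_B hw1])
    · exact key v (by rw [← hC v hv hvw hvd, prod_eq_zero H.w_mem_C hw1])
    · exact key v (by rw [← hD v hv hvd, prod_eq_zero H.d_mem_D hd1])
  have hm : lam ^ (k - 1) = lam * lam ^ (k - 2) := by
    rw [← pow_succ']; congr 1; omega
  have hmu : lam ^ k = lam * lam ^ (k - 1) := by
    rw [← pow_succ']; congr 1; omega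
  have hn0 : lam ^ (k - 2) ≠ 0 := pow_ne_zero _ hlam
  have hmu0 : lam ^ k ≠ 0 := pow_ne_zero _ hlam
  have hm0 : lam ^ (k - 1) ≠ 0 := pow_ne_zero _ hlam
  generalize (∏ u ∈ A, x u) = a at *
  generalize (∏ u ∈ B, x u) = b at *
  generalize (∏ u ∈ C, x u) = c at *
  generalize (∏ u ∈ D, x u) = f at *
  generalize x w ^ k = y at *
  generalize x d ^ k = z at *
  generalize lam ^ k = mu at *
  generalize lam ^ (k - 1) = m at *
  generalize lam ^ (k - 2) = n at *
  have hs : ∃ s : ℂ, (s = 0 ∨ s = 1 ∨ s = 2) ∧ m * c = (mu - s) * y := by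
    rcases eA with eA | eA <;> rcases eB with eB | eB
    · exact ⟨0, by simp, by linear_combination m * hw - m * eA - m * eB - y * hmu⟩
    · exact ⟨1, by simp, by linear_combination m * hw - m * eA - eB - y * hmu⟩
    · exact ⟨1, by simp, by linear_combination m * hw - eA - m * eB - y * hmu⟩
    · exact ⟨2, by simp, by linear_combination m * hw - eA - eB - y * hmu⟩
  have hdel : ∃ δ : ℂ, (δ = 0 ∨ δ = 1) ∧ m * c = (mu - δ) * z := by
    rcases eD with eD | eD
    · exact ⟨0, by simp, by linear_combination m * hd - m * eD - z * hmu⟩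
    · exact ⟨1, by simp, by linear_combination m * hd - eD - z * hmu⟩
  obtain ⟨s, hs, hcs⟩ := hs
  obtain ⟨δ, hδ, hcδ⟩ := hdel
  by_cases hc : c = 0
  · rw [hc, mul_zero, eq_comm, mul_eq_zero, sub_eq_zero] at hcs hcδ
    rcases hcs with rfl | hy
    · rcases hs with h | h | h
      · exact absurd h hmu0
      · exact Or.inl h
      · exact Or.inr (Or.inl h)
    · rcases hcδ with rfl | hz
      · rcases hδ with h | h
        · exact absurd h hmu0
        · exact Or.inl h
      · exact absurd ⟨hy, hz⟩ hne
  · have e := eC.resolve_left hc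
    have hq : mu = (mu - s) * (mu - δ) := by
      refine mul_right_cancel₀ (mul_ne_zero hn0 (pow_ne_zero 2 hc)) ?_
      have : m * c * (m * c) = (mu - s) * y * ((mu - δ) * z) := by rw [← hcs, ← hcδ]
      rw [e]
      linear_combination this + mu * e * (-1) + n * c ^ 2 * hmu - m * c ^ 2 * hm
    have cancel : ∀ r : ℂ, mu * mu = mu * r → mu = r := fun r h => mul_left_cancel₀ hmu0 h
    rcases hs with rfl | rfl | rfl <;> rcases hδ with rfl | rfl
    · exact Or.inl (cancel 1 (by linear_combination -hq))
    · exact Or.inr (Or.inl (cancel 2 (by linear_combination -hq)))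
    · exact Or.inr (Or.inl (cancel 2 (by linear_combination -hq)))
    · exact Or.inr (Or.inr (Or.inr (Or.inl (by linear_combination -hq))))
    · exact Or.inr (Or.inr (Or.inl (cancel 3 (by linear_combination -hq))))
    · exact Or.inr (Or.inr (Or.inr (Or.inr (by linear_combination -hq))))

/-- Vectors taking a single value on each class of similar vertices. -/
theorem isEigenvalue_of_classes (H : IsStar112 k A B C D w d) (hk : 3 ≤ k) {lam : ℂ}
    (a b c y f : ℂ)
    (hw : a ^ (k - 1) + (b ^ (k - 1) + y * c ^ (k - 2)) = lam)
    (hd : c ^ (k - 2) + f ^ (k - 1) = lam * y ^ (k - 1))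
    (ha : a ^ (k - 2) = lam * a ^ (k - 1)) (hb : b ^ (k - 2) = lam * b ^ (k - 1))
    (hc : y * c ^ (k - 3) = lam * c ^ (k - 1)) (hf : y * f ^ (k - 2) = lam * f ^ (k - 1)) :
    IsEigenvalue k {A, B, C, D} lam := by
  let x : V → ℂ := fun v => if v = w then 1 else if v = d then y else if v ∈ A then a else
    if v ∈ B then b else if v ∈ C then c else f
  have hdw := H.d_ne_w
  have xw : x w = 1 := by simp [x]
  have xd : x d = y := by simp [x, hdw]
  have xA : ∀ v ∈ A, v ≠ w → x v = a := by
    intro v hv hvw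
    have : v ≠ d := fun h => H.d_notMem_A (h ▸ hv)
    simp [x, hvw, this, hv]
  have xB : ∀ v ∈ B, v ≠ w → x v = b := by
    intro v hv hvw
    have hvd : v ≠ d := fun h => H.d_notMem_B (h ▸ hv)
    have hA' : v ∉ A := fun h => hvw (H.eq_of_AB v h hv)
    simp [x, hvw, hvd, hv, hA']
  have xC : ∀ v ∈ C, v ≠ w → v ≠ d → x v = c := by
    intro v hv hvw hvd
    have hA' : v ∉ A := fun h => hvw (H.eq_of_AC v h hv)
    have hB' : v ∉ B := fun h => hvw (H.eq_of_BC v h hv)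
    simp [x, hvw, hvd, hv, hA', hB']
  have xD : ∀ v ∈ D, v ≠ d → x v = f := by
    intro v hv hvd
    have hvw : v ≠ w := fun h => H.w_notMem_D (h ▸ hv)
    have hA' : v ∉ A := fun h => H.disj_AD v h hv
    have hB' : v ∉ B := fun h => H.disj_BD v h hv
    have hC' : v ∉ C := fun h => hvd (H.eq_of_CD v h hv)
    simp [x, hvw, hvd, hA', hB', hC']
  have root : ∀ {S : Finset V} {r : V} {z : ℂ}, S.card = k → r ∈ S →
      (∀ v ∈ S, v ≠ r → x v = z) → ∏ u ∈ S.erase r, x u = z ^ (k - 1) := by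
    intro S r z hS hr h
    rw [prod_congr rfl (fun v hv => h v (mem_of_mem_erase hv) (ne_of_mem_erase hv)),
      prod_const, card_erase_of_mem hr, hS]
  have leaf : ∀ {S : Finset V} {r v : V} {z : ℂ}, S.card = k → r ∈ S → v ∈ S → v ≠ r →
      (∀ u ∈ S, u ≠ r → u ≠ v → x u = z) → ∏ u ∈ S.erase v, x u = x r * z ^ (k - 2) := by
    intro S r v z hS hr hv hvr h
    have hr' : r ∈ S.erase v := mem_erase.2 ⟨hvr.symm, hr⟩
    rw [← mul_prod_erase _ _ hr', prod_congr rfl (fun u hu => h u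
      (mem_of_mem_erase (mem_of_mem_erase hu)) (ne_of_mem_erase hu)
      (ne_of_mem_erase (mem_of_mem_erase hu))),
      prod_const, card_erase_of_mem hr', card_erase_of_mem hv, hS, Nat.sub_sub]
  have pCw : ∏ u ∈ C.erase w, x u = y * c ^ (k - 2) := by
    rw [leaf H.card_C H.d_mem_C H.w_mem_C hdw.symm (fun u hu h1 h2 => xC u hu h2 h1), xd]
  have pCd : ∏ u ∈ C.erase d, x u = c ^ (k - 2) := by
    rw [leaf H.card_C H.w_mem_C H.d_mem_C hdw (fun u hu h1 h2 => xC u hu h1 h2), xw, one_mul]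
  refine ⟨x, fun h => one_ne_zero (xw.symm.trans (congrFun h w)), fun v => ?_⟩
  rw [H.sum_filter_mem hk (fun e => ∏ u ∈ e.erase v, x u) v]
  by_cases hvw : v = w
  · subst hvw
    simp only [H.w_mem_A, H.w_mem_B, H.w_mem_C, H.w_notMem_D, if_true, if_false, add_zero]
    rw [root H.card_A H.w_mem_A xA, root H.card_B H.w_mem_B xB, pCw, hw, xw, one_pow, mul_one]
  by_cases hvd : v = d
  · subst hvd
    simp only [H.d_notMem_A, H.d_notMem_B, H.d_mem_C, H.d_mem_D, if_true, if_false, zero_add]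
    rw [pCd, root H.card_D H.d_mem_D xD, hd, xd]
  rcases H.cover v with hv | hv | hv | hv
  · have hB' : v ∉ B := fun h => hvw (H.eq_of_AB v hv h)
    have hC' : v ∉ C := fun h => hvw (H.eq_of_AC v hv h)
    simp only [hv, hB', hC', H.disj_AD v hv, if_true, if_false, add_zero]
    rw [leaf H.card_A H.w_mem_A hv hvw (fun u hu h1 _ => xA u hu h1), xw, one_mul,
      xA v hv hvw, ha]
  · have hA' : v ∉ A := fun h => hvw (H.eq_of_AB v h hv)
    have hC' : v ∉ C := fun h => hvw (H.eq_of_BC v hv h)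
    simp only [hv, hA', hC', H.disj_BD v hv, if_true, if_false, add_zero, zero_add]
    rw [leaf H.card_B H.w_mem_B hv hvw (fun u hu h1 _ => xB u hu h1), xw, one_mul,
      xB v hv hvw, hb]
  · have hA' : v ∉ A := fun h => hvw (H.eq_of_AC v h hv)
    have hB' : v ∉ B := fun h => hvw (H.eq_of_BC v h hv)
    have hD' : v ∉ D := fun h => hvd (H.eq_of_CD v hv h)
    simp only [hv, hA', hB', hD', if_true, if_false, add_zero, zero_add]
    have hw' : w ∈ C.erase v := mem_erase.2 ⟨Ne.symm hvw, H.w_mem_C⟩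
    have hd' : d ∈ (C.erase v).erase w :=
      mem_erase.2 ⟨hdw, mem_erase.2 ⟨Ne.symm hvd, H.d_mem_C⟩⟩
    rw [← mul_prod_erase _ _ hw', ← mul_prod_erase _ _ hd', prod_congr rfl (fun u hu => xC u
      (mem_of_mem_erase (mem_of_mem_erase (mem_of_mem_erase hu)))
      (ne_of_mem_erase (mem_of_mem_erase hu)) (ne_of_mem_erase hu)),
      prod_const, card_erase_of_mem hd', card_erase_of_mem hw', card_erase_of_mem hv,
      H.card_C, xw, xd, one_mul, xC v hv hvw hvd, ← hc]
    rfl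
  · have hA' : v ∉ A := fun h => H.disj_AD v h hv
    have hB' : v ∉ B := fun h => H.disj_BD v h hv
    have hC' : v ∉ C := fun h => hvd (H.eq_of_CD v h hv)
    simp only [hv, hA', hB', hC', if_true, if_false, zero_add]
    rw [leaf H.card_D H.d_mem_D hv hvd (fun u hu h1 _ => xD u hu h1), xd, xD v hv hvd, hf]

/-- The parameters `α`, `β`, `δ` tell which of the three pendant edges are in the support of the
eigenvector. -/
theorem isEigenvalue_of_quadratic (H : IsStar112 k A B C D w d) (hk : 3 ≤ k) {lam : ℂ}
    (hlam : lam ≠ 0) {α β δ : ℂ} (hα : α = 0 ∨ α = 1) (hβ : β = 0 ∨ β = 1) (hδ : δ = 0 ∨ δ = 1)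
    (hq : (lam ^ k - (α + β)) * (lam ^ k - δ) = lam ^ k) :
    IsEigenvalue k {A, B, C, D} lam := by
  obtain ⟨n, rfl⟩ : ∃ n, k = n + 3 := ⟨k - 3, by omega⟩
  have hmu0 : lam ^ (n + 3) ≠ 0 := pow_ne_zero _ hlam
  obtain ⟨t, ht⟩ := IsAlgClosed.exists_pow_nat_eq (1 - (α + β) / lam ^ (n + 3))
    (show 0 < n + 3 by omega)
  have pw : ∀ {z : ℂ}, z = 0 ∨ z = 1 → ∀ m : ℕ, z ^ (m + 1) = z := by
    rintro z (rfl | rfl) m <;> simp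
  have ht' : lam ^ (n + 3) * t ^ (n + 3) = lam ^ (n + 3) - (α + β) := by
    rw [ht]; field_simp
  have hr : (lam ^ (n + 3) - δ) * t ^ (n + 3) = 1 := by
    refine mul_left_cancel₀ hmu0 ?_
    linear_combination (lam ^ (n + 3) - δ) * ht' + hq
  have ht0 : t ≠ 0 := by
    rintro rfl
    simp at hr
  refine H.isEigenvalue_of_classes hk (α / lam) (β / lam) t (lam * t ^ 2) (δ * t ^ 2)
    ?_ ?_ ?_ ?_ ?_ ?_
  all_goals simp only [Nat.add_sub_cancel, show n + 3 - 1 = n + 1 + 1 by omega,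
    show n + 3 - 2 = n + 1 by omega, div_pow, mul_pow, pw hα, pw hβ, pw hδ]
  · refine mul_left_cancel₀ (pow_ne_zero (n + 2) hlam) ?_
    field_simp
    linear_combination ht'
  · refine mul_left_cancel₀ (pow_ne_zero 2 ht0) ?_
    linear_combination (-t ^ (n + 3)) * hr
  · field_simp
    ring
  · field_simp
    ring
  · ring
  · ring

theorem isEigenvalue_zero (H : IsStar112 k A B C D w d) (hk : 3 ≤ k) :
    IsEigenvalue k {A, B, C, D} 0 := by
  have h1 : k - 1 ≠ 0 := by omega
  have h2 : k - 2 ≠ 0 := by omega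
  apply H.isEigenvalue_of_classes hk 0 0 0 0 0 <;> simp [h1, h2]

theorem isEigenvalue_iff (H : IsStar112 k A B C D w d) (hk : 3 ≤ k) (lam : ℂ) :
    IsEigenvalue k {A, B, C, D} lam ↔
      lam = 0 ∨ lam ^ k = 1 ∨ lam ^ k = 2 ∨ lam ^ k = 3 ∨
        (lam ^ k) ^ 2 - 3 * lam ^ k + 1 = 0 ∨ (lam ^ k) ^ 2 - 4 * lam ^ k + 2 = 0 := by
  constructor
  · exact fun h => or_iff_not_imp_left.2 fun h0 => H.pow_of_isEigenvalue hk h0 h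
  intro h
  by_cases h0 : lam = 0
  · exact h0 ▸ H.isEigenvalue_zero hk
  have z : (0 : ℂ) = 0 ∨ (0 : ℂ) = 1 := Or.inl rfl
  have o : (1 : ℂ) = 0 ∨ (1 : ℂ) = 1 := Or.inr rfl
  rcases h.resolve_left h0 with h | h | h | h | h
  · exact H.isEigenvalue_of_quadratic hk h0 z z z (by rw [h]; norm_num)
  · exact H.isEigenvalue_of_quadratic hk h0 o z z (by rw [h]; norm_num)
  · exact H.isEigenvalue_of_quadratic hk h0 o o z (by rw [h]; norm_num)
  · exact H.isEigenvalue_of_quadratic hk h0 o z o (by linear_combination h)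
  · exact H.isEigenvalue_of_quadratic hk h0 o o o (by linear_combination h)

end IsStar112

theorem none_mem_starEdge {k m : ℕ} {n : Fin m → ℕ} {i : Fin m} {t : ℕ} :
    (none : StarVertex k m n) ∈ starEdge k n i t ↔ t = 1 := by
  unfold starEdge
  split_ifs with h <;> simp [h]

theorem some_mem_starEdge {k m : ℕ} {n : Fin m → ℕ} {i : Fin m} {t : ℕ}
    {p : (j : Fin m) × Fin (n j * (k - 1))} :
    (some p : StarVertex k m n) ∈ starEdge k n i t ↔
      p.1 = i ∧ (t - 1) * (k - 1) ≤ p.2.val + 1 ∧ p.2.val + 1 ≤ t * (k - 1) := by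
  unfold starEdge
  split_ifs with h <;> simp

theorem card_starEdge {k m : ℕ} {n : Fin m → ℕ} {i : Fin m} {t : ℕ} (hk : 2 ≤ k)
    (ht : 1 ≤ t) (htn : t ≤ n i) : (starEdge k n i t).card = k := by
  obtain ⟨s, rfl⟩ : ∃ s, t = s + 1 := ⟨t - 1, by omega⟩
  have hle : (s + 1) * (k - 1) ≤ n i * (k - 1) := Nat.mul_le_mul_right _ htn
  have hsucc : (s + 1) * (k - 1) = s * (k - 1) + (k - 1) := Nat.succ_mul _ _
  let g : StarVertex k m n → ℕ := fun v => v.elim 0 (fun p => p.2.val + 1)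
  have himg : (starEdge k n i (s + 1)).image g =
      Icc (s * (k - 1)) ((s + 1) * (k - 1)) := by
    ext q
    simp only [mem_image, mem_Icc]
    constructor
    · rintro ⟨_ | p, hp, rfl⟩
      · have := none_mem_starEdge.1 hp
        obtain rfl : s = 0 := by omega
        simp [g]
      · exact (some_mem_starEdge.1 hp).2
    · rintro ⟨h1, h2⟩
      rcases q with _ | q
      · have : s = 0 := by
          rcases Nat.mul_eq_zero.1 (Nat.le_zero.1 h1) with h | h
          · exact h
          · omega
        exact ⟨none, none_mem_starEdge.2 (by omega), rfl⟩
      · exact ⟨some ⟨i, ⟨q, by omega⟩⟩, some_mem_starEdge.2 ⟨rfl, h1, h2⟩, rfl⟩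
  have hinj : Set.InjOn g (starEdge k n i (s + 1)) := by
    rintro (_ | ⟨j, p⟩) hp (_ | ⟨j', p'⟩) hp' h
    · rfl
    · simp [g] at h
    · simp [g] at h
    · obtain rfl : j = i := (some_mem_starEdge.1 hp).1
      obtain rfl : j' = j := (some_mem_starEdge.1 hp').1
      have : p = p' := Fin.ext (by simpa [g] using h)
      rw [this]
  rw [← card_image_of_injOn hinj, himg, Nat.card_Icc]
  omega

theorem starEdges_112 (k : ℕ) :
    starEdges k ![1, 1, 2] = {starEdge k ![1, 1, 2] 0 1, starEdge k ![1, 1, 2] 1 1,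
      starEdge k ![1, 1, 2] 2 1, starEdge k ![1, 1, 2] 2 2} := by
  have h1 : ∀ a, 1 ≤ a ∧ a ≤ 1 ↔ a = 1 := by omega
  have h2 : ∀ a, 1 ≤ a ∧ a ≤ 2 ↔ a = 1 ∨ a = 2 := by omega
  ext e
  simp [starEdges, Fin.exists_fin_succ, h1, h2, or_and_right, exists_or, eq_comm (b := e)]

theorem isStar112_starEdge {k : ℕ} (hk : 3 ≤ k) :
    IsStar112 k (starEdge k ![1, 1, 2] 0 1) (starEdge k ![1, 1, 2] 1 1)
      (starEdge k ![1, 1, 2] 2 1) (starEdge k ![1, 1, 2] 2 2) none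
      (some ⟨2, ⟨k - 2, show k - 2 < 2 * (k - 1) by omega⟩⟩) where
  card_A := card_starEdge (by omega) le_rfl le_rfl
  card_B := card_starEdge (by omega) le_rfl le_rfl
  card_C := card_starEdge (by omega) le_rfl (show 1 ≤ 2 by omega)
  card_D := card_starEdge (by omega) (by omega) (show 2 ≤ 2 by omega)
  w_mem_A := none_mem_starEdge.2 rfl
  w_mem_B := none_mem_starEdge.2 rfl
  w_mem_C := none_mem_starEdge.2 rfl
  w_notMem_D := fun h => absurd (none_mem_starEdge.1 h) (by omega)
  d_notMem_A := fun h => absurd (some_mem_starEdge.1 h).1 (by simp)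
  d_notMem_B := fun h => absurd (some_mem_starEdge.1 h).1 (by simp)
  d_mem_C := some_mem_starEdge.2 ⟨rfl, by simp only; omega, by simp only; omega⟩
  d_mem_D := some_mem_starEdge.2 ⟨rfl, by simp only; omega, by simp only; omega⟩
  eq_of_AB := by
    rintro (_ | p) h h'
    · rfl
    · exact absurd ((some_mem_starEdge.1 h).1.symm.trans (some_mem_starEdge.1 h').1) (by simp)
  eq_of_AC := by
    rintro (_ | p) h h'
    · rfl
    · exact absurd ((some_mem_starEdge.1 h).1.symm.trans (some_mem_starEdge.1 h').1) (by simp)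
  eq_of_BC := by
    rintro (_ | p) h h'
    · rfl
    · exact absurd ((some_mem_starEdge.1 h).1.symm.trans (some_mem_starEdge.1 h').1) (by simp)
  disj_AD := by
    rintro (_ | p) h h'
    · exact absurd (none_mem_starEdge.1 h') (by omega)
    · exact absurd ((some_mem_starEdge.1 h).1.symm.trans (some_mem_starEdge.1 h').1) (by simp)
  disj_BD := by
    rintro (_ | p) h h'
    · exact absurd (none_mem_starEdge.1 h') (by omega)
    · exact absurd ((some_mem_starEdge.1 h).1.symm.trans (some_mem_starEdge.1 h').1) (by simp)
  eq_of_CD := by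
    rintro (_ | ⟨j, p⟩) h h'
    · exact absurd (none_mem_starEdge.1 h') (by omega)
    · obtain ⟨hj, -, h1⟩ := some_mem_starEdge.1 h
      obtain ⟨-, h2, -⟩ := some_mem_starEdge.1 h'
      obtain rfl : j = 2 := hj
      have : p = ⟨k - 2, show k - 2 < 2 * (k - 1) by omega⟩ :=
        Fin.ext (by simp only at h1 h2 ⊢; omega)
      rw [this]
  cover := by
    rintro (_ | ⟨j, p⟩)
    · exact Or.inl (none_mem_starEdge.2 rfl)
    · simp only [some_mem_starEdge]
      have hp := p.2
      fin_cases j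
      · have hp' : p.val < 1 * (k - 1) := hp
        exact Or.inl ⟨rfl, by omega, by omega⟩
      · have hp' : p.val < 1 * (k - 1) := hp
        exact Or.inr (Or.inl ⟨rfl, by omega, by omega⟩)
      · have hp' : p.val < 2 * (k - 1) := hp
        rcases Nat.lt_or_ge p.val (k - 1) with h | h
        · exact Or.inr (Or.inr (Or.inl ⟨rfl, by omega, by omega⟩))
        · exact Or.inr (Or.inr (Or.inr ⟨rfl, by omega, by omega⟩))

/-- For `k ≥ 3`, a complex number `λ` is an eigenvalue of the `k`-uniform
starlike hypergraph `S^k_{1,1,2}` iff `λ = 0`, `λ^k ∈ {1, 2, 3}`,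
`λ^{2k} - 3λ^k + 1 = 0`, or `λ^{2k} - 4λ^k + 2 = 0`. -/
theorem starlike_112_eigenvalue_iff (k : ℕ) (hk : 3 ≤ k) (lam : ℂ) :
    IsEigenvalue k (starEdges k ![1, 1, 2]) lam ↔
      lam = 0 ∨ lam ^ k = 1 ∨ lam ^ k = 2 ∨ lam ^ k = 3 ∨
        lam ^ (2 * k) - 3 * lam ^ k + 1 = 0 ∨
        lam ^ (2 * k) - 4 * lam ^ k + 2 = 0 := by
  rw [starEdges_112, (isStar112_starEdge hk).isEigenvalue_iff hk lam, mul_comm 2 k, pow_mul]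
end

section
/- Let k ≥ 3, n ≥ 1, let c₀ be a stable configuration on P_n^k, and let c be any configuration occurring in a legal firing sequence starting from c₀ in which the bank vertex 0 is fired exactly once (at the first step). Then for every t ∈ {1, …, n}: the vertex t(k−1) is the largest vertex v ≠ 0 with c(v) ≥ k−1 if and only if c(t(k−1)) = k−1. -/
open Finset

/-- Vertex `v` belongs to the edge `e_t = {(t-1)(k-1), …, t(k-1)}` of the
hyperpath `P_n^k`. -/
def inEdge (k t v : ℕ) : Prop := (t - 1) * (k - 1) ≤ v ∧ v ≤ t * (k - 1)

instance (k t v : ℕ) : Decidable (inEdge k t v) :=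
  inferInstanceAs (Decidable (_ ∧ _))

/-- Firing the vertex `u` on the edge `e_t` of `P_n^k`: `u` loses `k-1` dollars
and every other vertex of `e_t` gains one dollar. -/
def fireStep (k t u : ℕ) (c : ℕ → ℤ) : ℕ → ℤ := fun v =>
  if v = u then c u - ((k : ℤ) - 1)
  else if inEdge k t v then c v + 1
  else c v

/-- A configuration on `P_n^k` (bank vertex `0`) is stable: at every vertex
`v ≠ 0` its value lies in `{0, …, k-2}`. -/
def StableConf (k n : ℕ) (c : ℕ → ℤ) : Prop :=
  ∀ v, 1 ≤ v → v ≤ n * (k - 1) → 0 ≤ c v ∧ c v ≤ (k : ℤ) - 2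

/-- A legal firing sequence on the hyperpath `P_n^k` with bank vertex `0`,
starting from a stable configuration `conf 0`, in which the bank is fired
exactly once, at the first step (on the edge `e₁`).  At every later step the
fired vertex is the largest vertex `v ≠ 0` whose value is `≥ k-1`, fired on
some edge containing it. -/
structure FiringSeq (k n : ℕ) where
  /-- the number of firing steps -/
  len : ℕ
  /-- the configurations `conf 0, conf 1, …, conf len` -/
  conf : ℕ → ℕ → ℤ
  /-- the vertex fired at step `j` (for `j < len`) -/
  vert : ℕ → ℕ
  /-- the index of the edge on which step `j` fires (for `j < len`) -/
  edg : ℕ → ℕ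
  one_le_len : 1 ≤ len
  start_stable : StableConf k n (conf 0)
  edg_mem : ∀ j < len, 1 ≤ edg j ∧ edg j ≤ n
  vert_mem : ∀ j < len, inEdge k (edg j) (vert j)
  conf_step : ∀ j < len, conf (j + 1) = fireStep k (edg j) (vert j) (conf j)
  first_vert : vert 0 = 0
  first_edg : edg 0 = 1
  bank_once : ∀ j, 1 ≤ j → j < len → vert j ≠ 0
  fire_legal : ∀ j, 1 ≤ j → j < len →
    (k : ℤ) - 1 ≤ conf j (vert j) ∧
    ∀ v, vert j < v → v ≤ n * (k - 1) → conf j v < (k : ℤ) - 1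

/-- Every vertex of the hyperpath `P_n^{m+1}` beyond `p` is stable. -/
def StableAbove (m n p : ℕ) (c : ℕ → ℤ) : Prop :=
  ∀ v, p < v → v ≤ n * m → c v < m

/-- The state of the edge following the cut vertex `t * m`, after that vertex has fired on this
edge and before all vertices beyond it are stable again: `F` is the set of the other vertices of
the edge that have since fired on it. -/
structure Excursion (m n t : ℕ) (c : ℕ → ℤ) (F : Finset ℕ) : Prop where
  subset : F ⊆ Ioc (t * m) (t * m + m)
  card_lt : F.card < m
  cut_le : c (t * m) ≤ F.card
  fired_lt : ∀ v ∈ F, c v < F.card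
  unfired_le : ∀ v, t * m < v → v < t * m + m → v ∉ F → c v ≤ m + F.card
  last_fired : t * m + m ∈ F → StableAbove m n (t * m + m) c

/-- The invariant of a legal firing sequence at the cut vertex `t * m`. -/
def CutInvariant (m n t : ℕ) (c : ℕ → ℤ) : Prop :=
  c (t * m) ≤ m ∧ (StableAbove m n (t * m) c ∨ ∃ F, Excursion m n t c F)

section FireStep

variable {m s u v : ℕ} {c : ℕ → ℤ}

theorem fireStep_self : fireStep (m + 1) s u c u = c u - m := by
  simp [fireStep]

theorem fireStep_of_mem (hv : v ≠ u) (h : (s - 1) * m ≤ v ∧ v ≤ s * m) :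
    fireStep (m + 1) s u c v = c v + 1 := by
  simp [fireStep, inEdge, hv, h]

theorem fireStep_of_lt (hv : v ≠ u) (h : v < (s - 1) * m) :
    fireStep (m + 1) s u c v = c v := by
  simp [fireStep, inEdge, hv, h]

theorem fireStep_of_gt (hv : v ≠ u) (h : s * m < v) :
    fireStep (m + 1) s u c v = c v := by
  simp [fireStep, inEdge, hv, h]

end FireStep

section Step

variable {m n t s u : ℕ} {c : ℕ → ℤ}

theorem CutInvariant.fireStep_edge_le (hc : CutInvariant m n t c) (htn : t ≤ n) (hst : s ≤ t)
    (hmem : (s - 1) * m ≤ u ∧ u ≤ s * m) (hsta : StableAbove m n u c) :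
    CutInvariant m n t (fireStep (m + 1) s u c) := by
  have hsm : s * m ≤ t * m := Nat.mul_le_mul_right m hst
  have htm : t * m ≤ n * m := Nat.mul_le_mul_right m htn
  refine ⟨?_, Or.inl fun v hv hvn => ?_⟩
  · rcases eq_or_ne (t * m) u with h | h
    · have := hc.1
      rw [h] at this ⊢
      rw [fireStep_self]
      omega
    · have := hsta (t * m) (by omega) htm
      rcases hsm.lt_or_eq with h' | h'
      · rw [fireStep_of_gt h h']
        omega
      · rw [fireStep_of_mem h (by omega)]
        omega
  · rw [fireStep_of_gt (by omega) (by omega)]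
    exact hsta v (by omega) hvn

theorem CutInvariant.fireStep_cut (hm : 0 < m) (hc : CutInvariant m n t c) (htn : t + 1 ≤ n)
    (hsta : StableAbove m n (t * m) c) :
    CutInvariant m n t (fireStep (m + 1) (t + 1) (t * m) c) := by
  have hw : (t + 1) * m = t * m + m := by ring
  have hwn : (t + 1) * m ≤ n * m := Nat.mul_le_mul_right m htn
  have hcut := hc.1
  refine ⟨by rw [fireStep_self]; omega, Or.inr ⟨∅, by simp, by simpa, ?_, by simp, ?_, by simp⟩⟩
  · rw [fireStep_self]
    simpa using hcut
  · intro v hv hvw _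
    have := hsta v hv (by omega)
    rw [fireStep_of_mem hv.ne' (by simp; omega)]
    simp only [card_empty]
    omega

theorem Excursion.fireStep_edge {F : Finset ℕ} (hF : Excursion m n t c F)
    (hnext : c (t * m + m) ≤ m) (hut : t * m < u)
    (huw : u ≤ t * m + m) (hu : (m : ℤ) ≤ c u) (hsta : StableAbove m n u c) :
    CutInvariant m n t (fireStep (m + 1) (t + 1) u c) := by
  have hw : (t + 1) * m = t * m + m := by ring
  have huF : u ∉ F := fun h => by
    have := hF.fired_lt u h
    have := hF.card_lt
    omega
  have hcard : (insert u F).card = F.card + 1 := card_insert_of_notMem huF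
  have hlt := hF.card_lt
  have hsub : insert u F ⊆ Ioc (t * m) (t * m + m) :=
    insert_subset (mem_Ioc.2 ⟨hut, huw⟩) hF.subset
  have hin : ∀ v, t * m ≤ v → v ≤ t * m + m → v ≠ u →
      fireStep (m + 1) (t + 1) u c v = c v + 1 := fun v h h' hvu =>
    fireStep_of_mem hvu (by simp; omega)
  have habove : StableAbove m n (t * m + m) (fireStep (m + 1) (t + 1) u c) := fun v hv hvn => by
    rw [fireStep_of_gt (by omega) (by omega)]
    exact hsta v (by omega) hvn
  have hcut : fireStep (m + 1) (t + 1) u c (t * m) ≤ F.card + 1 := by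
    rw [hin _ le_rfl (by omega) hut.ne]
    have := hF.cut_le
    omega
  have hfired : ∀ v ∈ insert u F, fireStep (m + 1) (t + 1) u c v < F.card + 1 := by
    intro v hv
    rcases eq_or_ne v u with rfl | hvu
    · rw [fireStep_self]
      rcases huw.lt_or_eq with h | rfl
      · have := hF.unfired_le v hut h huF
        omega
      · omega
    · have hvF := mem_of_mem_insert_of_ne hv hvu
      have hv' := mem_Ioc.1 (hF.subset hvF)
      rw [hin v hv'.1.le hv'.2 hvu]
      have := hF.fired_lt v hvF
      omega
  refine ⟨by omega, ?_⟩
  rcases (Nat.succ_le_of_lt hlt).lt_or_eq with h | h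
  · refine Or.inr ⟨insert u F, hsub, by omega, by omega, fun v hv => ?_, ?_, fun _ => habove⟩
    · have := hfired v hv
      omega
    · intro v hv hvw hvF
      rw [mem_insert, not_or] at hvF
      have := hF.unfired_le v hv hvw hvF.2
      rw [hin v hv.le hvw.le hvF.1]
      omega
  · have hfull : insert u F = Ioc (t * m) (t * m + m) :=
      eq_of_subset_of_card_le hsub (by rw [Nat.card_Ioc]; omega)
    refine Or.inl fun v hv hvn => ?_
    rcases le_or_gt v (t * m + m) with h' | h'
    · have := hfired v (hfull ▸ mem_Ioc.2 ⟨hv, h'⟩)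
      omega
    · exact habove v h' hvn

theorem Excursion.fireStep_beyond {F : Finset ℕ} (hF : Excursion m n t c F)
    (hs : t + 2 ≤ s) (hsn : s ≤ n) (hmem : (s - 1) * m ≤ u ∧ u ≤ s * m) (hu : (m : ℤ) ≤ c u) :
    Excursion m n t (fireStep (m + 1) s u c) F := by
  have hw : (t + 1) * m = t * m + m := by ring
  have hws : (t + 1) * m ≤ (s - 1) * m := Nat.mul_le_mul_right m (by omega)
  have hsm : s * m ≤ n * m := Nat.mul_le_mul_right m hsn
  have hlt := hF.card_lt
  have hwF : t * m + m ∉ F := fun h => by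
    rcases (show t * m + m ≤ u by omega).lt_or_eq with h' | rfl
    · have := hF.last_fired h u h' (by omega)
      omega
    · have := hF.fired_lt _ h
      omega
  have hsame : ∀ v, v < t * m + m → fireStep (m + 1) s u c v = c v := fun v hv =>
    fireStep_of_lt (by omega) (by omega)
  refine ⟨hF.subset, hlt, ?_, fun v hv => ?_, fun v hv hvw hvF => ?_, fun h => absurd h hwF⟩
  · rw [hsame _ (by omega)]
    exact hF.cut_le
  · have hv' := mem_Ioc.1 (hF.subset hv)
    rw [hsame v (lt_of_le_of_ne hv'.2 fun h => hwF (h ▸ hv))]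
    exact hF.fired_lt v hv
  · rw [hsame v hvw]
    exact hF.unfired_le v hv hvw hvF

/-- A legal firing of a vertex other than the bank preserves the invariant at all cut vertices. -/
theorem cutInvariant_fireStep (hm : 0 < m) (hc : ∀ t, 1 ≤ t → t ≤ n → CutInvariant m n t c)
    (hsn : s ≤ n) (hmem : (s - 1) * m ≤ u ∧ u ≤ s * m) (hu : (m : ℤ) ≤ c u)
    (hsta : StableAbove m n u c) (ht : 1 ≤ t) (htn : t ≤ n) :
    CutInvariant m n t (fireStep (m + 1) s u c) := by
  have hw : (t + 1) * m = t * m + m := by ring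
  have hsm : s * m ≤ n * m := Nat.mul_le_mul_right m hsn
  have hct := hc t ht htn
  rcases le_or_gt s t with hst | hst
  · exact hct.fireStep_edge_le htn hst hmem hsta
  have hexc : t * m < u → ∃ F, Excursion m n t c F := fun h =>
    hct.2.resolve_left fun h' => by
      have := h' u h (by omega)
      omega
  rcases (Nat.succ_le_of_lt hst).lt_or_eq with hs | rfl
  · have hws : (t + 1) * m ≤ (s - 1) * m := Nat.mul_le_mul_right m (by omega)
    obtain ⟨F, hF⟩ := hexc (by omega)
    refine ⟨?_, Or.inr ⟨F, hF.fireStep_beyond hs hsn hmem hu⟩⟩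
    rw [fireStep_of_lt (by omega) (by omega)]
    exact hct.1
  · rw [Nat.succ_eq_add_one, Nat.add_sub_cancel, hw] at hmem
    rcases hmem.1.lt_or_eq with h | rfl
    · obtain ⟨F, hF⟩ := hexc h
      have hnext := (hc (t + 1) (by omega) hsn).1
      rw [hw] at hnext
      exact hF.fireStep_edge hnext h hmem.2 hu hsta
    · exact hct.fireStep_cut hm hsn hsta

end Step

/-- Firing the bank in a stable configuration establishes the invariant at all cut vertices. -/
theorem StableConf.cutInvariant_fireStep {m n t : ℕ} {c : ℕ → ℤ} (hm : 0 < m)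
    (hc : StableConf (m + 1) n c) (ht : 1 ≤ t) (htn : t ≤ n) :
    CutInvariant m n t (fireStep (m + 1) 1 0 c) := by
  have hmt : 1 * m ≤ t * m := Nat.mul_le_mul_right m ht
  have htm : t * m ≤ n * m := Nat.mul_le_mul_right m htn
  have hlt : ∀ v, 1 ≤ v → v ≤ n * m → c v < m := fun v hv hvn => by
    have := (hc v hv hvn).2
    push_cast at this
    omega
  refine ⟨?_, Or.inl fun v hv hvn => ?_⟩
  · have := hlt (t * m) (by omega) htm
    simp only [fireStep]
    split_ifs <;> omega
  · rw [fireStep_of_gt (by omega) (by omega)]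
    exact hlt v (by omega) hvn

theorem FiringSeq.cutInvariant {m n : ℕ} (hm : 0 < m) (S : FiringSeq (m + 1) n) {j : ℕ}
    (hj : j + 1 ≤ S.len) : ∀ t, 1 ≤ t → t ≤ n → CutInvariant m n t (S.conf (j + 1)) := by
  induction j with
  | zero =>
    intro t ht htn
    rw [S.conf_step 0 hj, S.first_vert, S.first_edg]
    exact S.start_stable.cutInvariant_fireStep hm ht htn
  | succ j ih =>
    intro t ht htn
    rw [S.conf_step (j + 1) hj]
    obtain ⟨hu, hsta⟩ := S.fire_legal (j + 1) (by omega) hj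
    push_cast at hu hsta
    rw [add_sub_cancel_right] at hu hsta
    exact cutInvariant_fireStep hm (ih (by omega)) (S.edg_mem _ hj).2 (S.vert_mem _ hj) hu hsta
      ht htn

/-- In any configuration `c` occurring in a legal firing sequence on `P_n^k`
starting from a stable configuration (bank fired exactly once, at the first
step), for every `t ∈ {1,…,n}`: the vertex `t(k-1)` is the largest vertex
`v ≠ 0` with `c v ≥ k-1` if and only if `c (t(k-1)) = k-1`. -/
theorem hyperpath_fired_iff (k n : ℕ) (hk : 3 ≤ k) (hn : 1 ≤ n)
    (S : FiringSeq k n) (j : ℕ) (hj : j ≤ S.len)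
    (t : ℕ) (ht1 : 1 ≤ t) (htn : t ≤ n) :
    ((k : ℤ) - 1 ≤ S.conf j (t * (k - 1)) ∧
      ∀ v, t * (k - 1) < v → v ≤ n * (k - 1) → S.conf j v < (k : ℤ) - 1) ↔
    S.conf j (t * (k - 1)) = (k : ℤ) - 1 := by
  obtain ⟨m, rfl⟩ : ∃ m, k = m + 1 := ⟨k - 1, by omega⟩
  have hm : 0 < m := by omega
  simp only [Nat.add_sub_cancel, Nat.cast_add, Nat.cast_one, add_sub_cancel_right]
  cases j with
  | zero =>
    have hmt : 1 * m ≤ t * m := Nat.mul_le_mul_right m ht1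
    have := (S.start_stable (t * m) (by omega) (Nat.mul_le_mul_right m htn)).2
    push_cast at this
    constructor
    · intro h
      omega
    · intro h
      omega
  | succ j =>
    obtain ⟨hle, h | ⟨F, hF⟩⟩ := S.cutInvariant hm hj t ht1 htn
    · exact ⟨fun h' => le_antisymm hle h'.1, fun h' => ⟨h'.ge, h⟩⟩
    · have := hF.cut_le
      have := hF.card_lt
      constructor
      · intro h
        omega
      · intro h
        omega
end

section
/- Let k ≥ 3, n ≥ 1 and let c₀ be a stable configuration on P_n^k. In any legal firing sequence starting from c₀ in which the bank vertex 0 is fired exactly once (at the first step), every vertex v ∈ {1, …, k−1} is fired on the edge e₁ at most once. -/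
open Finset

namespace FiringSeq

variable {k n : ℕ}

/-- The number of steps `j ∈ [a, b)` that fire on the edge `e_t`. -/
def edgeCount (S : FiringSeq k n) (t a b : ℕ) : ℤ :=
  ∑ j ∈ Ico a b, if S.edg j = t then 1 else 0

/-- The number of steps `j ∈ [a, b)` that fire the vertex `u` on the edge `e_t`. -/
def fireCount (S : FiringSeq k n) (t u a b : ℕ) : ℤ :=
  ∑ j ∈ Ico a b, if S.edg j = t ∧ S.vert j = u then 1 else 0

theorem edgeCount_self (S : FiringSeq k n) (t a : ℕ) : S.edgeCount t a a = 0 := by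
  simp [edgeCount]

theorem fireCount_self (S : FiringSeq k n) (t u a : ℕ) : S.fireCount t u a a = 0 := by
  simp [fireCount]

theorem edgeCount_succ (S : FiringSeq k n) (t : ℕ) {a b : ℕ} (h : a ≤ b) :
    S.edgeCount t a (b + 1) = S.edgeCount t a b + if S.edg b = t then 1 else 0 :=
  sum_Ico_succ_top h _

theorem fireCount_succ (S : FiringSeq k n) (t u : ℕ) {a b : ℕ} (h : a ≤ b) :
    S.fireCount t u a (b + 1) =
      S.fireCount t u a b + if S.edg b = t ∧ S.vert b = u then 1 else 0 :=
  sum_Ico_succ_top h _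

theorem edgeCount_add (S : FiringSeq k n) (t : ℕ) {a b c : ℕ} (h : a ≤ b) (h' : b ≤ c) :
    S.edgeCount t a b + S.edgeCount t b c = S.edgeCount t a c :=
  sum_Ico_consecutive _ h h'

theorem fireCount_add (S : FiringSeq k n) (t u : ℕ) {a b c : ℕ} (h : a ≤ b) (h' : b ≤ c) :
    S.fireCount t u a b + S.fireCount t u b c = S.fireCount t u a c :=
  sum_Ico_consecutive _ h h'

theorem one_le_fireCount (S : FiringSeq k n) {t u a b j : ℕ} (haj : a ≤ j) (hjb : j < b)
    (ht : S.edg j = t) (hu : S.vert j = u) : 1 ≤ S.fireCount t u a b := by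
  have h := single_le_sum (s := Ico a b)
    (f := fun i => if S.edg i = t ∧ S.vert i = u then (1 : ℤ) else 0)
    (fun i _ => by positivity) (mem_Ico.2 ⟨haj, hjb⟩)
  simpa [fireCount, ht, hu] using h

/-- If no vertex is fired twice on `e_{s+1}` during `[a, b)`, there are at most `k` firings
on that edge. -/
theorem edgeCount_le (S : FiringSeq k n) (hk : 1 ≤ k) {s a b : ℕ} (hb : b ≤ S.len)
    (hinj : Set.InjOn S.vert {j | a ≤ j ∧ j < b ∧ S.edg j = s + 1}) :
    S.edgeCount (s + 1) a b ≤ k := by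
  have hcard : #{j ∈ Ico a b | S.edg j = s + 1} ≤ #(Icc (s * (k - 1)) ((s + 1) * (k - 1))) := by
    refine card_le_card_of_injOn S.vert (fun j hj => ?_) (hinj.mono fun j hj => ?_)
    · simp only [coe_filter, mem_Ico, Set.mem_ofPred_eq] at hj
      have h := S.vert_mem j (by omega)
      rw [hj.2] at h
      simpa [inEdge] using h
    · simpa [and_assoc] using hj
  have hIcc : #(Icc (s * (k - 1)) ((s + 1) * (k - 1))) = k := by
    rw [Nat.card_Icc, add_one_mul]
    omega
  rw [hIcc] at hcard
  rw [edgeCount, sum_boole]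
  exact_mod_cast hcard

/-- The edges through a vertex of `e_{s+1}` other than its first one are `e_{s+1}` and, for the
last vertex, `e_{s+2}`. -/
theorem _root_.inEdge_iff_of_mem {k s t u : ℕ} (hk : 2 ≤ k) (ht : 1 ≤ t)
    (hu : s * (k - 1) < u) (hu' : u ≤ (s + 1) * (k - 1)) :
    inEdge k t u ↔ t = s + 1 ∨ t = s + 2 ∧ u = (s + 1) * (k - 1) := by
  obtain ⟨w, rfl⟩ : ∃ w, k = w + 2 := ⟨k - 2, by omega⟩
  obtain ⟨r, rfl⟩ : ∃ r, t = r + 1 := ⟨t - 1, by omega⟩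
  simp only [inEdge, Nat.add_sub_cancel, show w + 2 - 1 = w + 1 by omega] at *
  constructor
  · rintro ⟨h₁, h₂⟩
    have hlt : s < r + 1 := lt_of_mul_lt_mul_right (hu.trans_le h₂) (Nat.zero_le _)
    have hle : r ≤ s + 1 := le_of_mul_le_mul_right (h₁.trans hu') (Nat.succ_pos w)
    obtain rfl | rfl : r = s ∨ r = s + 1 := by omega
    · exact Or.inl rfl
    · exact Or.inr ⟨rfl, le_antisymm hu' h₁⟩
  · rintro (h | ⟨h, rfl⟩)
    · obtain rfl : r = s := by omega
      exact ⟨hu.le, hu'⟩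
    · obtain rfl : r = s + 1 := by omega
      exact ⟨le_rfl, Nat.mul_le_mul_right _ (Nat.le_succ _)⟩

/-- The balance of a vertex `u` of `e_{s+1}` other than its first one. -/
theorem conf_eq (S : FiringSeq k n) (hk : 2 ≤ k) {s u a b : ℕ} (hab : a ≤ b) (hb : b ≤ S.len)
    (hu : s * (k - 1) < u) (hu' : u ≤ (s + 1) * (k - 1)) :
    S.conf b u = S.conf a u + (S.edgeCount (s + 1) a b - k * S.fireCount (s + 1) u a b) +
      if u = (s + 1) * (k - 1) then
        S.edgeCount (s + 2) a b - k * S.fireCount (s + 2) u a b else 0 := by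
  induction b, hab using Nat.le_induction with
  | base => simp [edgeCount_self, fireCount_self]
  | succ b hab ih =>
    have hedge := inEdge_iff_of_mem hk (S.edg_mem b (by omega)).1 hu hu'
    have hvert := S.vert_mem b (by omega)
    rw [S.conf_step b (by omega), fireStep, S.edgeCount_succ _ hab, S.fireCount_succ _ _ hab,
      S.edgeCount_succ _ hab, S.fireCount_succ _ _ hab]
    have ih := ih (by omega)
    by_cases huv : u = S.vert b
    · rw [← huv] at hvert ⊢
      rcases hedge.1 hvert with h | ⟨h, hlast⟩
      · simp only [h, if_true, and_self]
        split_ifs at ih ⊢ <;> first | omega | (simp at *; linarith)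
      · simp only [h, if_true, and_self, if_pos hlast] at ih ⊢
        simp
        linarith
    · simp only [if_neg huv, Ne.symm huv, and_false, if_false, hedge]
      split_ifs at ih ⊢ <;> first | omega | linarith

/-- The vertices beyond the first vertex `s(k-1)` of `e_{s+1}` return to it at most as many dollars
through `e_{s+1}` as they receive from it, provided that in every round started by firing `s(k-1)`
on `e_{s+1}` no vertex is fired twice on that edge. -/
theorem edgeCount_le_fireCount (S : FiringSeq k n) (hk : 2 ≤ k) {s a b : ℕ} (hab : a ≤ b)
    (hb : b ≤ S.len) (hvert : S.vert a ≤ s * (k - 1))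
    (hstable : ∀ v, s * (k - 1) < v → v ≤ n * (k - 1) → S.conf a v < (k : ℤ) - 1)
    (hround : ∀ i c, i < c → c ≤ S.len → S.edg i = s + 1 → S.vert i = s * (k - 1) →
      (∀ v, s * (k - 1) < v → v ≤ n * (k - 1) → S.conf i v < (k : ℤ) - 1) →
      (∀ j, i < j → j < c → s * (k - 1) < S.vert j) →
      Set.InjOn S.vert {j | i ≤ j ∧ j < c ∧ S.edg j = s + 1}) :
    S.edgeCount (s + 1) a b ≤ k * S.fireCount (s + 1) (s * (k - 1)) a b := by
  induction b using Nat.strong_induction_on with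
  | _ b ih =>
  obtain rfl | hlt := hab.eq_or_lt
  · simp [edgeCount_self, fireCount_self]
  obtain ⟨i, ⟨hi, hiv⟩, hmax⟩ : ∃ i, (i ∈ Ico a b ∧ S.vert i ≤ s * (k - 1)) ∧
      ∀ j, i < j → j < b → s * (k - 1) < S.vert j := by
    obtain ⟨i, hi, hmax⟩ := exists_max_image {i ∈ Ico a b | S.vert i ≤ s * (k - 1)} id
      ⟨a, by simp [hlt, hvert]⟩
    rw [mem_filter] at hi
    refine ⟨i, hi, fun j hj hjb => ?_⟩
    by_contra! hle
    have hai := (mem_Ico.1 hi.1).1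
    exact absurd (hmax j (mem_filter.2 ⟨mem_Ico.2 ⟨by omega, hjb⟩, hle⟩)) (not_le.2 hj)
  rw [mem_Ico] at hi
  have hprev := ih i hi.2 hi.1 (by omega)
  have hst : ∀ v, s * (k - 1) < v → v ≤ n * (k - 1) → S.conf i v < (k : ℤ) - 1 := by
    intro v hv hvn
    obtain rfl | hai := hi.1.eq_or_lt
    · exact hstable v hv hvn
    · exact (S.fire_legal i (by omega) (by omega)).2 v (by omega) hvn
  rw [← S.edgeCount_add _ hi.1 hi.2.le, ← S.fireCount_add _ _ hi.1 hi.2.le]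
  by_cases hie : S.edg i = s + 1
  · have hiv' : S.vert i = s * (k - 1) := by
      have h := (S.vert_mem i (by omega)).1
      rw [hie, Nat.add_sub_cancel] at h
      omega
    have h₁ := S.edgeCount_le (by omega) hb (hround i b hi.2 hb hie hiv' hst hmax)
    have h₂ := S.one_le_fireCount le_rfl hi.2 hie hiv'
    nlinarith
  · have hbi : b = i + 1 := by
      by_contra hne
      have hlen : i + 1 < S.len := by omega
      have hbig := hmax (i + 1) (by omega) (by omega)
      have hn : S.vert (i + 1) ≤ n * (k - 1) :=
        (S.vert_mem _ hlen).2.trans (Nat.mul_le_mul_right _ (S.edg_mem _ hlen).2)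
      have hlegal := (S.fire_legal (i + 1) (by omega) hlen).1
      have hout : ¬ inEdge k (S.edg i) (S.vert (i + 1)) := by
        intro hin
        have h := (S.vert_mem i (by omega)).1
        have h₁ : S.edg i - 1 ≤ s := le_of_mul_le_mul_right (h.trans hiv) (by omega)
        have h₂ : S.edg i * (k - 1) ≤ s * (k - 1) := Nat.mul_le_mul_right _ (by omega)
        exact absurd hin.2 (by omega)
      rw [S.conf_step i (by omega), fireStep, if_neg (by omega), if_neg hout] at hlegal
      exact absurd (hst _ hbig hn) (by omega)
    subst hbi
    simpa [edgeCount_succ, fireCount_succ, edgeCount_self, fireCount_self, hie] using hprev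

/-- During a round started by firing the first vertex of `e_{s+1}` while everything beyond it is
stable, no vertex is fired twice on `e_{s+1}`. -/
theorem injOn_vert_round (S : FiringSeq k n) (hk : 2 ≤ k) {s a b : ℕ} (hab : a < b)
    (hb : b ≤ S.len) (hvert : S.vert a = s * (k - 1))
    (hstable : ∀ v, s * (k - 1) < v → v ≤ n * (k - 1) → S.conf a v < (k : ℤ) - 1)
    (hround : ∀ j, a < j → j < b → s * (k - 1) < S.vert j) :
    Set.InjOn S.vert {j | a ≤ j ∧ j < b ∧ S.edg j = s + 1} := by
  induction hd : n - s generalizing s a b with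
  | zero =>
    rintro i ⟨-, hi, he⟩
    have := (S.edg_mem i (by omega)).2
    omega
  | succ d ihd =>
  have key : ∀ i j, a ≤ i → i < j → j < b → S.edg i = s + 1 → S.edg j = s + 1 →
      S.vert i ≠ S.vert j := by
    intro i j
    induction j using Nat.strong_induction_on generalizing i with
    | _ j ih =>
    intro hai hij hjb hei hej heq
    have hinj : Set.InjOn S.vert {l | a ≤ l ∧ l < j ∧ S.edg l = s + 1} := by
      rintro x ⟨hax, hxj, hex⟩ y ⟨hay, hyj, hey⟩ hxy
      rcases lt_trichotomy x y with h | h | h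
      · exact absurd hxy (ih y hyj x hax h (by omega) hex hey)
      · exact h
      · exact absurd hxy.symm (ih x hxj y hay h (by omega) hey hex)
    have hu := hround j (by omega) hjb
    have hu' : S.vert j ≤ (s + 1) * (k - 1) := by
      have h := (S.vert_mem j (by omega)).2
      rwa [hej] at h
    have hn : S.vert j ≤ n * (k - 1) := hu'.trans (Nat.mul_le_mul_right _ (by omega))
    have hconf := S.conf_eq hk (a := a) (b := j) (by omega) (by omega) hu hu'
    have hlegal := (S.fire_legal j (by omega) (by omega)).1
    have hD := S.edgeCount_le (by omega) (by omega) hinj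
    have hN := S.one_le_fireCount hai hij hei heq
    have hst := hstable _ hu hn
    have hsucc : s * (k - 1) ≤ (s + 1) * (k - 1) := Nat.mul_le_mul_right _ (Nat.le_succ s)
    have hright := S.edgeCount_le_fireCount hk (s := s + 1) (a := a) (b := j) (by omega)
      (by omega) (by omega) (fun v hv => hstable v (by omega))
      (fun i c hic hc _ hiv hist hir => ihd hic hc hiv hist hir (by omega))
    split_ifs at hconf with hlast
    · rw [← hlast] at hright
      nlinarith
    · nlinarith
  rintro x ⟨hax, hxb, hex⟩ y ⟨hay, hyb, hey⟩ hxy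
  rcases lt_trichotomy x y with h | h | h
  · exact absurd hxy (key x y hax h hyb hex hey)
  · exact h
  · exact absurd hxy.symm (key y x hay h hxb hey hex)

end FiringSeq

/-- In any legal firing sequence on `P_n^k` starting from a stable
configuration, with the bank vertex `0` fired exactly once (at the first step),
every vertex `v ∈ {1,…,k-1}` is fired on the edge `e₁` at most once. -/
theorem hyperpath_fire_once (k n : ℕ) (hk : 3 ≤ k) (hn : 1 ≤ n)
    (S : FiringSeq k n) (v : ℕ) (hv1 : 1 ≤ v) (hv2 : v ≤ k - 1) :
    ((Finset.range S.len).filter (fun j => S.vert j = v ∧ S.edg j = 1)).card ≤ 1 := by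
  have hinj := S.injOn_vert_round (by omega) (s := 0) (a := 0) S.one_le_len le_rfl
    (by simpa using S.first_vert)
    (fun u hu hun => by
      have := (S.start_stable u (by omega) hun).2
      omega)
    (fun j hj hjl => by
      have := S.bank_once j hj hjl
      omega)
  refine card_le_one.2 fun i hi j hj => ?_
  simp only [mem_filter, mem_range] at hi hj
  exact hinj ⟨Nat.zero_le _, hi.1, hi.2.2⟩ ⟨Nat.zero_le _, hj.1, hj.2.2⟩
    (hi.2.1.trans hj.2.1.symm)
end

section
/- Let k ≥ 3, n ≥ 2, 1 ≤ s ≤ n−1, and let c₀ ∈ B_s. Then there exists a legal firing sequence starting from c₀, with the bank vertex 0 fired exactly once at the first step, in which at some step the vertex s(k−1) is fired on the edge e_{s+1}. -/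
open Finset

/-- Firing the vertex `u` on the complete graph `K_k` with vertex set
`{0, …, k-1}`: `u` loses `k-1` dollars and every other vertex gains one. -/
def fireK (k u : ℕ) (d : ℕ → ℤ) : ℕ → ℤ := fun v =>
  if v = u then d u - ((k : ℤ) - 1)
  else if v ≤ k - 1 then d v + 1
  else d v

/-- A configuration on `K_k` (vertices `{0,…,k-1}`, bank vertex `0`) is stable:
every non-bank vertex has value in `{0, …, k-2}`. -/
def StableK (k : ℕ) (d : ℕ → ℤ) : Prop :=
  ∀ v, 1 ≤ v → v ≤ k - 1 → 0 ≤ d v ∧ d v ≤ (k : ℤ) - 2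

/-- A stable configuration `d` on the complete graph `K_k` (vertices
`{0,…,k-1}`, bank vertex `0`) is critical: there is a nonempty `0`-legal firing
sequence starting and ending at `d` (non-bank vertices are fired only when
their value is `≥ k-1`; the bank is fired only at a stable configuration). -/
def CriticalK (k : ℕ) (d : ℕ → ℤ) : Prop :=
  StableK k d ∧
  ∃ (N : ℕ) (cs : ℕ → ℕ → ℤ) (vs : ℕ → ℕ),
    1 ≤ N ∧ cs 0 = d ∧ cs N = d ∧
    (∀ j < N, vs j ≤ k - 1) ∧
    (∀ j < N, cs (j + 1) = fireK k (vs j) (cs j)) ∧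
    (∀ j < N, vs j ≠ 0 → (k : ℤ) - 1 ≤ cs j (vs j)) ∧
    (∀ j < N, vs j = 0 → StableK k (cs j))

/-- The configuration `c̃^i` induced on the complete graph with vertex set
`e_i` and bank vertex `(i-1)(k-1)` by a configuration `c` on `P_n^k`. -/
def inducedConf (k i : ℕ) (c : ℕ → ℤ) : ℕ → ℤ := fun j => c ((i - 1) * (k - 1) + j)

/-- Membership of a configuration `c` on `P_n^k` in the set `B_s`
(for `0 ≤ s ≤ n`): `c` is stable, `c̃^i` is critical for `1 ≤ i ≤ s`, and,
if `s < n`, `c̃^{s+1}` is not critical. -/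
def MemB (k n s : ℕ) (c : ℕ → ℤ) : Prop :=
  StableConf k n c ∧
  (∀ i, 1 ≤ i → i ≤ s → CriticalK k (inducedConf k i c)) ∧
  (s < n → ¬ CriticalK k (inducedConf k (s + 1) c))

/-- Along firings of `K_k`, a vertex that is never fired gains one dollar at each step. -/
lemma unfired_gain {k : ℕ} {cs : ℕ → ℕ → ℤ} {vs : ℕ → ℕ} {v a : ℕ} (hv : v ≤ k - 1) (r : ℕ)
    (hstep : ∀ j, a ≤ j → j < a + r → cs (j + 1) = fireK k (vs j) (cs j))
    (hne : ∀ j, a ≤ j → j < a + r → vs j ≠ v) :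
    cs (a + r) v = cs a v + r := by
  induction r with
  | zero => simp
  | succ r ih =>
    have ih' := ih (fun j h1 h2 => hstep j h1 (by omega)) (fun j h1 h2 => hne j h1 (by omega))
    have h := hne (a + r) (by omega) (by omega)
    rw [← add_assoc, hstep (a + r) (by omega) (by omega), fireK, if_neg (Ne.symm h), if_pos hv, ih']
    push_cast
    ring

/-- In a critical configuration on `K_k`, each nonempty set `T` of non-bank vertices contains a
vertex with at least `#T - 1` dollars. -/
lemma CriticalK.exists_card_le {k : ℕ} {d : ℕ → ℤ} (hd : CriticalK k d) (T : Finset ℕ)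
    (hT : T.Nonempty) (hT' : ∀ v ∈ T, 1 ≤ v ∧ v ≤ k - 1) :
    ∃ v ∈ T, (#T : ℤ) ≤ d v + 1 := by
  obtain ⟨-, N, cs, vs, hN, h0, hNd, -, hstep, hpos, -⟩ := hd
  have key : ∀ v ∈ T, ∃ j < N, vs j = v ∧ (N : ℤ) - 1 - j ≤ d v := by
    intro v hv
    obtain ⟨hv1, hvk⟩ := hT' v hv
    have hfire : ((range N).filter (fun j => vs j = v)).Nonempty := by
      by_contra hcon
      rw [not_nonempty_iff_eq_empty, filter_eq_empty_iff] at hcon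
      have h := unfired_gain (a := 0) hvk N (fun j _ h2 => hstep j (by omega))
        (fun j _ h2 => hcon (mem_range.2 (by omega)))
      rw [zero_add, hNd, h0] at h
      omega
    obtain ⟨j, hj, hmax⟩ := exists_max_image _ id hfire
    simp only [mem_filter, mem_range, id] at hj hmax
    refine ⟨j, hj.1, hj.2, ?_⟩
    have h := unfired_gain (a := j + 1) hvk (N - (j + 1)) (fun i _ h2 => hstep i (by omega))
      (fun i h1 h2 h3 => by have := hmax i ⟨by omega, h3⟩; omega)
    have hj' : cs (j + 1) v = cs j v - ((k : ℤ) - 1) := by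
      rw [hstep j hj.1, hj.2, fireK, if_pos rfl]
    have hp := hpos j hj.1 (by omega)
    rw [hj.2] at hp
    rw [show j + 1 + (N - (j + 1)) = N by omega, hNd] at h
    omega
  choose! last hlast hvs hle using key
  by_contra! hcon
  have hinj : Set.InjOn (fun v => N - 1 - last v) T := by
    intro v hv w hw h
    have h1 := hlast v hv
    have h2 := hlast w hw
    have h3 : last v = last w := by simp only at h; omega
    rw [← hvs v hv, ← hvs w hw, h3]
  have hmaps : Set.MapsTo (fun v => N - 1 - last v) T (range (#T - 1)) := by
    intro v hv
    have h1 := hlast v hv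
    have h2 := hle v hv
    have h3 := hcon v hv
    simp only [coe_range, Set.mem_Iio]
    omega
  have := card_le_card_of_injOn _ hmaps hinj
  have := hT.card_pos
  rw [card_range] at *
  omega

/-- The sequence consisting of the firing of the bank alone. -/
def FiringSeq.bank {k n : ℕ} (hn : 1 ≤ n) (c : ℕ → ℤ) (hc : StableConf k n c) :
    FiringSeq k n where
  len := 1
  conf j := if j = 0 then c else fireStep k 1 0 c
  vert _ := 0
  edg _ := 1
  one_le_len := le_rfl
  start_stable := hc
  edg_mem _ _ := ⟨le_rfl, hn⟩
  vert_mem _ _ := by simp [inEdge]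
  conf_step j hj := by
    obtain rfl : j = 0 := by omega
    simp
  first_vert := rfl
  first_edg := rfl
  bank_once j h1 h2 := by omega
  fire_legal j h1 h2 := by omega

/-- Extending a legal firing sequence by one more legal firing. -/
def FiringSeq.snoc {k n : ℕ} (S : FiringSeq k n) (t u : ℕ) (ht : 1 ≤ t ∧ t ≤ n)
    (hu : inEdge k t u) (hu0 : u ≠ 0)
    (hlegal : (k : ℤ) - 1 ≤ S.conf S.len u ∧
      ∀ v, u < v → v ≤ n * (k - 1) → S.conf S.len v < (k : ℤ) - 1) :
    FiringSeq k n where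
  len := S.len + 1
  conf j := if j ≤ S.len then S.conf j else fireStep k t u (S.conf S.len)
  vert j := if j < S.len then S.vert j else u
  edg j := if j < S.len then S.edg j else t
  one_le_len := by omega
  start_stable := by simpa using S.start_stable
  edg_mem j hj := by
    split_ifs with h
    exacts [S.edg_mem j h, ht]
  vert_mem j hj := by
    split_ifs with h
    exacts [S.vert_mem j h, hu]
  conf_step j hj := by
    by_cases h : j < S.len
    · simp [h, h.le, Nat.succ_le_of_lt h, S.conf_step j h]
    · obtain rfl : j = S.len := by omega
      simp
  first_vert := by rw [if_pos (Nat.lt_of_succ_le S.one_le_len), S.first_vert]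
  first_edg := by rw [if_pos (Nat.lt_of_succ_le S.one_le_len), S.first_edg]
  bank_once j h1 hj := by
    split_ifs with h
    exacts [S.bank_once j h1 h, hu0]
  fire_legal j h1 hj := by
    by_cases h : j < S.len
    · simpa [h, h.le] using S.fire_legal j h1 h
    · obtain rfl : j = S.len := by omega
      simpa using hlegal

lemma FiringSeq.snoc_conf_len {k n : ℕ} (S : FiringSeq k n) (t u : ℕ) (ht : 1 ≤ t ∧ t ≤ n)
    (hu : inEdge k t u) (hu0 : u ≠ 0)
    (hlegal : (k : ℤ) - 1 ≤ S.conf S.len u ∧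
      ∀ v, u < v → v ≤ n * (k - 1) → S.conf S.len v < (k : ℤ) - 1) :
    (S.snoc t u ht hu hu0 hlegal).conf (S.snoc t u ht hu hu0 hlegal).len =
      fireStep k t u (S.conf S.len) := by
  simp [FiringSeq.snoc]

/-- The final configuration of `S` agrees, beyond the vertex `i * m`, with the one obtained from
`c` by firing `i * m` and then each vertex of `F` once, all on the edge `e_{i+1}` of
`P_n^{m+1}`. -/
def FiredInEdge {m n : ℕ} (c : ℕ → ℤ) (i : ℕ) (F : Finset ℕ) (S : FiringSeq (m + 1) n) : Prop :=
  S.conf 0 = c ∧ ∀ v, i * m < v → S.conf S.len v =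
    c v + (if v ∈ F then (#F : ℤ) - m else if v ≤ (i + 1) * m then (#F : ℤ) + 1 else 0)

/-- There is a legal firing sequence from `c` whose last step fires `i * m` on `e_{i+1}`, no
vertex beyond `i * m` having received money before. -/
def ReachesEdge (m n : ℕ) (c : ℕ → ℤ) (i : ℕ) : Prop :=
  ∃ S : FiringSeq (m + 1) n, FiredInEdge c i ∅ S ∧
    ∃ j < S.len, S.vert j = i * m ∧ S.edg j = i + 1

lemma reachesEdge_zero {m n : ℕ} (hn : 1 ≤ n) {c : ℕ → ℤ} (hc : StableConf (m + 1) n c) :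
    ReachesEdge m n c 0 := by
  refine ⟨FiringSeq.bank hn c hc, ⟨rfl, fun v hv => ?_⟩, 0, Nat.one_pos, by simp [FiringSeq.bank],
    rfl⟩
  have hv0 : v ≠ 0 := by omega
  by_cases h : v ≤ m <;> simp [FiringSeq.bank, fireStep, inEdge, hv0, h]

/-- Firing the largest unstable vertex of `e_{i+1}`, either on `e_{i+1}` or, if it is the last
one, on `e_{i+2}`. -/
lemma FiredInEdge.step {m n i : ℕ} {c : ℕ → ℤ} (hm : 1 ≤ m) (hc : StableConf (m + 1) n c)
    (hi : i + 2 ≤ n) (hcrit : CriticalK (m + 1) (inducedConf (m + 1) (i + 1) c))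
    {F : Finset ℕ} (hF : F ⊆ Ioo (i * m) ((i + 1) * m)) {S : FiringSeq (m + 1) n}
    (hS : FiredInEdge c i F S) :
    ReachesEdge m n c (i + 1) ∨ ∃ u ∉ F, insert u F ⊆ Ioo (i * m) ((i + 1) * m) ∧
      ∃ S' : FiringSeq (m + 1) n, FiredInEdge c i (insert u F) S' := by
  obtain ⟨hS0, hSv⟩ := hS
  have hsucc : (i + 1) * m = i * m + m := by ring
  have hsucc2 : (i + 1 + 1) * m = i * m + m + m := by ring
  have hin : i * m + m + m ≤ n * m := by rw [← hsucc2]; exact Nat.mul_le_mul_right m hi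
  have hFm : #F ≤ m - 1 := by simpa [hsucc] using card_le_card hF
  have hFsub : F ⊆ Ioc (i * m) ((i + 1) * m) := hF.trans Ioo_subset_Ioc_self
  have hcard : #(Ioc (i * m) ((i + 1) * m) \ F) = m - #F := by
    rw [card_sdiff_of_subset hFsub, Nat.card_Ioc, hsucc]; simp
  -- some vertex of `e_{i+1}` is unstable
  have hex : ((Ioc (i * m) ((i + 1) * m)).filter
      (fun v => (m : ℤ) ≤ S.conf S.len v)).Nonempty := by
    set T := (Ioc (i * m) ((i + 1) * m) \ F).image (fun v => v - i * m) with hTdef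
    have hTcard : #T = m - #F := by
      rw [← hcard]
      refine card_image_of_injOn fun v hv w hw h => ?_
      simp only [coe_sdiff, coe_Ioc, Set.mem_sdiff, Set.mem_Ioc] at hv hw h
      omega
    obtain ⟨w, hwT, hw⟩ := hcrit.exists_card_le T (card_pos.1 (by omega)) (by
      intro w hw
      simp only [hTdef, mem_image, mem_sdiff, mem_Ioc] at hw
      omega)
    simp only [hTdef, mem_image, mem_sdiff, mem_Ioc] at hwT
    obtain ⟨v, ⟨hv, hvF⟩, rfl⟩ := hwT
    refine ⟨v, mem_filter.2 ⟨mem_Ioc.2 hv, ?_⟩⟩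
    rw [hSv v hv.1, if_neg hvF, if_pos hv.2]
    simp only [inducedConf, Nat.add_sub_cancel, Nat.add_sub_cancel' hv.1.le] at hw
    omega
  obtain ⟨u, hu, hmax⟩ := exists_max_image _ id hex
  simp only [mem_filter, mem_Ioc, id] at hu hmax
  obtain ⟨⟨hu1, hu2⟩, hu3⟩ := hu
  have huF : u ∉ F := by
    intro h
    have h1 := (hc u (by omega) (by simp only [Nat.add_sub_cancel]; omega)).2
    rw [hSv u hu1, if_pos h] at hu3
    push_cast at h1
    omega
  have hlegal : ((m + 1 : ℕ) : ℤ) - 1 ≤ S.conf S.len u ∧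
      ∀ v, u < v → v ≤ n * (m + 1 - 1) → S.conf S.len v < ((m + 1 : ℕ) : ℤ) - 1 := by
    refine ⟨by push_cast; omega, fun v huv hvn => ?_⟩
    push_cast
    by_cases hv : v ≤ (i + 1) * m
    · by_contra hcon
      have := hmax v ⟨⟨by omega, hv⟩, by omega⟩
      omega
    · have hvF : v ∉ F := fun h => hv (mem_Ioc.1 (hFsub h)).2
      have h1 := (hc v (by omega) hvn).2
      rw [hSv v (by omega), if_neg hvF, if_neg hv]
      push_cast at h1
      omega
  rcases hu2.eq_or_lt with rfl | hlt
  · left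
    refine ⟨S.snoc (i + 1 + 1) ((i + 1) * m) ⟨by omega, hi⟩
      (by simp only [inEdge, Nat.add_sub_cancel]; omega) (by omega) hlegal,
      ⟨by simpa [FiringSeq.snoc] using hS0, fun v hv => ?_⟩, S.len, by simp [FiringSeq.snoc],
      by simp [FiringSeq.snoc], by simp [FiringSeq.snoc]⟩
    have hvF : v ∉ F := fun h => by have := (mem_Ioc.1 (hFsub h)).2; omega
    have hconf := hSv v (by omega)
    rw [if_neg hvF, if_neg (by omega), add_zero] at hconf
    rw [FiringSeq.snoc_conf_len]
    simp only [fireStep, inEdge, Nat.add_sub_cancel, hv.le, hv.ne', true_and, if_false,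
      notMem_empty, card_empty, Nat.cast_zero, zero_add, hconf]
    split_ifs <;> omega
  · right
    refine ⟨u, huF, insert_subset (mem_Ioo.2 ⟨hu1, hlt⟩) hF,
      S.snoc (i + 1) u ⟨by omega, by omega⟩
        (by simp only [inEdge, Nat.add_sub_cancel]; omega) (by omega) hlegal,
      by simpa [FiringSeq.snoc] using hS0, fun v hv => ?_⟩
    have hconf := hSv v hv
    rw [card_insert_of_notMem huF, FiringSeq.snoc_conf_len]
    by_cases hvu : v = u
    · subst hvu
      rw [if_neg huF, if_pos hu2] at hconf
      simp [fireStep, hconf]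
      ring
    · simp only [fireStep, inEdge, Nat.add_sub_cancel, hv.le, hvu, true_and,
        if_false, mem_insert, false_or, hconf]
      have hFle : v ∈ F → v ≤ (i + 1) * m := fun h => (mem_Ioc.1 (hFsub h)).2
      push_cast
      split_ifs <;> first | omega | simp_all

lemma FiredInEdge.reachesEdge_succ {m n i : ℕ} {c : ℕ → ℤ} (hm : 1 ≤ m)
    (hc : StableConf (m + 1) n c) (hi : i + 2 ≤ n)
    (hcrit : CriticalK (m + 1) (inducedConf (m + 1) (i + 1) c)) (r : ℕ) :
    ∀ {F : Finset ℕ}, F ⊆ Ioo (i * m) ((i + 1) * m) → m ≤ #F + r →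
      ∀ {S : FiringSeq (m + 1) n}, FiredInEdge c i F S → ReachesEdge m n c (i + 1) := by
  induction r with
  | zero =>
    intro F hF hr
    have h := card_le_card hF
    rw [Nat.card_Ioo, show (i + 1) * m = i * m + m by ring] at h
    omega
  | succ r ih =>
    intro F hF hr S hS
    obtain h | ⟨u, huF, hsub, S', hS'⟩ := hS.step hm hc hi hcrit hF
    · exact h
    · exact ih hsub (by rw [card_insert_of_notMem huF]; omega) hS'

/-- For `1 ≤ s ≤ n-1` and `c₀ ∈ B_s`, there is a legal firing sequence starting
from `c₀` (bank fired exactly once, at the first step) in which at some step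
the vertex `s(k-1)` is fired on the edge `e_{s+1}`. -/
theorem hyperpath_reaches_next_edge (k n s : ℕ) (hk : 3 ≤ k) (hn : 2 ≤ n)
    (hs1 : 1 ≤ s) (hs2 : s ≤ n - 1) (c0 : ℕ → ℤ) (hc0 : MemB k n s c0) :
    ∃ S : FiringSeq k n, S.conf 0 = c0 ∧
      ∃ j < S.len, S.vert j = s * (k - 1) ∧ S.edg j = s + 1 := by
  obtain ⟨m, rfl⟩ : ∃ m, k = m + 1 := ⟨k - 1, by omega⟩
  obtain ⟨hst, hcrit, -⟩ := hc0
  have key : ∀ i ≤ s, ReachesEdge m n c0 i := by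
    intro i
    induction i with
    | zero => exact fun _ => reachesEdge_zero (by omega) hst
    | succ i ih =>
      intro hi
      obtain ⟨S, hS, -⟩ := ih (by omega)
      exact hS.reachesEdge_succ (by omega) hst (by omega) (hcrit (i + 1) (by omega) hi) m
        (empty_subset _) (by omega)
  obtain ⟨S, ⟨hS0, -⟩, hj⟩ := key s le_rfl
  exact ⟨S, hS0, hj⟩
end
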